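/- arXiv:1909.04081 — 5 statements merged into one kernel-verified Lean document; each statement's English description precedes it below -/
import Mathlib

section
/- Let F_e ⊆ E(BS_4) with |F_e| ≤ 10. If BS_4 − F_e is disconnected, then BS_4 − F_e has a connected component H with at least 4! − 2 = 22 vertices. -/
open SimpleGraph

/-- Adjacency relation of the bubble-sort star graph: `y` is obtained from `x` by
swapping the symbols at positions `i` and `j` (0-indexed), where either `j = i+1`
(an adjacent transposition, i.e. positions `k-1, k` for `k ∈ [2,n]`) or `i = 0`
(a star transposition, i.e. positions `1, k` for `k ∈ [2,n]`). -/
def BSRel (n : ℕ) (x y : Equiv.Perm (Fin n)) : Prop :=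
  ∃ i j : Fin n, (j.val = i.val + 1 ∨ i.val = 0) ∧ i ≠ j ∧ y = x * Equiv.swap i j

/-- The n-dimensional bubble-sort star graph `BS_n` on the permutations of `{1,…,n}`. -/
def BS (n : ℕ) : SimpleGraph (Equiv.Perm (Fin n)) :=
  SimpleGraph.fromRel (BSRel n)

/-- The degree of a vertex, as the cardinality of its neighbour set. -/
noncomputable def deg {V : Type*} (G : SimpleGraph V) (v : V) : ℕ :=
  (G.neighborSet v).ncard

/-- `G` contains `m` pairwise edge-disjoint paths joining `u` and `v`. -/
def HasEdgeDisjointPaths {V : Type*} (G : SimpleGraph V) (u v : V) (m : ℕ) : Prop :=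
  ∃ P : Fin m → G.Path u v, ∀ i j : Fin m, i ≠ j →
    List.Disjoint ((P i : G.Walk u v).edges) ((P j : G.Walk u v).edges)

/-- Adjacency matrix of `BS 4` as an integer-valued function. -/
def adjB (p q : Equiv.Perm (Fin 4)) : Bool :=
  q == p * Equiv.swap 0 1 || q == p * Equiv.swap 0 2 || q == p * Equiv.swap 0 3 ||
  q == p * Equiv.swap 1 2 || q == p * Equiv.swap 2 3

def adjZ (p q : Equiv.Perm (Fin 4)) : ℤ := if adjB p q = true then 1 else 0

/-- Lexicographic rank of a permutation. -/
def rk (p : Equiv.Perm (Fin 4)) : ℕ :=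
  6 * (p 0).val
   + 2 * ((if p 2 < p 1 then 1 else 0) + (if p 3 < p 1 then 1 else 0))
   + (if p 3 < p 2 then 1 else 0)

/-- Certificate (an LDL decomposition) that `36 I - 12 A + J` is positive semidefinite. -/
def cert : List (ℤ × List ℤ) :=
  [(23718322249018430895854892900, [37, -11, -11, 1, 1, 1, -11, 1, 1, 1, 1, 1, 1, 1, -11, 1, 1, 1, 1, 1, 1, -11, 1, 1]),
   (2736729490271357411060179950, [0, 104, -7, 4, -33, 4, -7, -33, 4, 4, 4, 4, 4, 4, -7, -33, 4, 4, 4, 4, -33, -7, 4, 4]),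
   (347969041718351285942359650, [0, 0, 291, -92, 5, 12, -21, 5, -92, 12, 12, 12, -92, 12, -21, 5, 12, 12, 12, 12, 5, -21, 12, -92]),
   (44457961104064537761677400, [0, 0, 0, 814, 38, -258, 15, 38, -59, -258, 33, 33, -59, -258, 15, 38, 33, 33, 33, 33, 38, 15, -258, -59]),
   (22776877960004895226493175, [0, 0, 0, 0, 1136, -344, 20, -85, 57, 63, -363, 44, 57, 63, 20, -85, 44, -363, -363, 44, -85, 20, 63, 57]),
   (206004207327155385715171605, [0, 0, 0, 0, 0, 360, 22, 13, 13, -23, -23, -122, 13, -23, 22, 13, -122, -23, -23, -122, 13, 22, -23, 13]),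
   (29311219880216497767088545, [0, 0, 0, 0, 0, 0, 998, -343, -343, 53, 53, 62, -343, 53, -82, 17, 62, 53, 53, -298, 17, -82, 53, 17]),
   (67575433916171033327475, [0, 0, 0, 0, 0, 0, 0, 19519, -1439, 1779, -7203, 1648, -1439, -6205, -248, -1689, 1648, 781, -7203, -1096, -1689, -248, 1779, 1305]),
   (11367936459896955964740, [0, 0, 0, 0, 0, 0, 0, 0, 47460, -17289, 3051, 4326, -11097, 791, -20170, 2886, 4326, 4490, 3051, -2877, 2886, -651, -17289, -3894]),
   (221890751760728683475760060, [0, 0, 0, 0, 0, 0, 0, 0, 0, 339, 39, -126, -13, -21, -30, -106, 14, 30, 39, 7, 34, 21, -81, -146]),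
   (345163391627800174295626760, [0, 0, 0, 0, 0, 0, 0, 0, 0, 0, 270, -90, 23, -15, 27, 5, -103, -27, -69, 5, -121, 15, 39, 41]),
   (2761307133022401394365014080, [0, 0, 0, 0, 0, 0, 0, 0, 0, 0, 0, 90, 13, 0, 12, -5, -23, -42, 0, -5, -5, -30, 0, -5]),
   (582141242596140592468743640, [0, 0, 0, 0, 0, 0, 0, 0, 0, 0, 0, 0, 201, -85, -121, 15, 39, 41, -67, -15, 27, 5, -13, -27]),
   (1531950638410896295970378, [0, 0, 0, 0, 0, 0, 0, 0, 0, 0, 0, 0, 0, 3800, -727, 228, -1377, 650, -871, -1836, 330, 344, -412, -129]),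
   (541375015605647860795158, [0, 0, 0, 0, 0, 0, 0, 0, 0, 0, 0, 0, 0, 0, 5119, -3116, 2169, 2950, -913, -908, -2010, -368, -1636, -1287]),
   (3246114491994417153485760, [0, 0, 0, 0, 0, 0, 0, 0, 0, 0, 0, 0, 0, 0, 0, 2535, 675, -675, -8, 121, -668, -1304, -233, -443]),
   (35607557323970188732914868800, [0, 0, 0, 0, 0, 0, 0, 0, 0, 0, 0, 0, 0, 0, 0, 0, 21, -21, -1, -6, 1, 6, -8, 8]),
   (33431539931949788310347849040, [0, 0, 0, 0, 0, 0, 0, 0, 0, 0, 0, 0, 0, 0, 0, 0, 0, 0, 24, -17, -17, 3, 3, 4]),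
   (5707823890820695565181340080, [0, 0, 0, 0, 0, 0, 0, 0, 0, 0, 0, 0, 0, 0, 0, 0, 0, 0, 0, 41, -31, 21, -51, 20]),
   (4109633201390900806930564857600, [0, 0, 0, 0, 0, 0, 0, 0, 0, 0, 0, 0, 0, 0, 0, 0, 0, 0, 0, 0, 1, -2, -1, 2])]

def scaleN : ℤ := 877577923213681943146631037300

def qf (l : List (ℤ × List ℤ)) (p q : Equiv.Perm (Fin 4)) : ℤ :=
  (l.map fun t => t.1 * ((t.2.getD (rk p) 0) * (t.2.getD (rk q) 0))).sum

lemma cert_nonneg : ∀ t ∈ cert, (0 : ℤ) ≤ t.1 := by decide +kernel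

lemma cert_eq : ∀ p q : Equiv.Perm (Fin 4),
    scaleN * ((if p = q then 36 else 0) - 12 * adjZ p q + 1) = qf cert p q := by
  decide +kernel

lemma row_sum : ∀ p : Equiv.Perm (Fin 4), ∑ q, adjZ p q = 5 := by decide +kernel

lemma bip : ∀ p q : Equiv.Perm (Fin 4),
    2 * adjZ p q ≤ 1 - (Equiv.Perm.sign p : ℤ) * (Equiv.Perm.sign q : ℤ) := by
  decide +kernel

lemma qf_nonneg (l : List (ℤ × List ℤ)) (hl : ∀ t ∈ l, (0 : ℤ) ≤ t.1)
    (S : Finset (Equiv.Perm (Fin 4))) : 0 ≤ ∑ p ∈ S, ∑ q ∈ S, qf l p q := by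
  induction l with
  | nil => simp [qf]
  | cons t l ih =>
    have h1 := ih (fun s hs => hl s (List.mem_cons_of_mem _ hs))
    have h2 : ∑ p ∈ S, ∑ q ∈ S, qf (t :: l) p q
        = t.1 * (∑ p ∈ S, t.2.getD (rk p) 0) ^ 2 + ∑ p ∈ S, ∑ q ∈ S, qf l p q := by
      rw [pow_two, Finset.sum_mul_sum, Finset.mul_sum, ← Finset.sum_add_distrib]
      refine Finset.sum_congr rfl fun p _ => ?_
      rw [Finset.mul_sum, ← Finset.sum_add_distrib]
      refine Finset.sum_congr rfl fun q _ => ?_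
      simp [qf]
    rw [h2]
    have := hl t List.mem_cons_self
    positivity

lemma inner_spectral (S : Finset (Equiv.Perm (Fin 4))) :
    12 * ∑ p ∈ S, ∑ q ∈ S, adjZ p q ≤ 36 * (S.card : ℤ) + (S.card : ℤ) ^ 2 := by
  have h := qf_nonneg cert cert_nonneg S
  have h2 : ∑ p ∈ S, ∑ q ∈ S, qf cert p q = scaleN * (36 * (S.card : ℤ)
      - 12 * ∑ p ∈ S, ∑ q ∈ S, adjZ p q + (S.card : ℤ) ^ 2) := by
    simp_rw [← cert_eq, ← Finset.mul_sum, Finset.sum_add_distrib, Finset.sum_sub_distrib,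
      ← Finset.mul_sum]
    congr 1
    simp
    ring
  rw [h2] at h
  have h3 : (0 : ℤ) < scaleN := by decide +kernel
  have := nonneg_of_mul_nonneg_right h h3
  linarith

lemma inner_mantel (S : Finset (Equiv.Perm (Fin 4))) :
    2 * ∑ p ∈ S, ∑ q ∈ S, adjZ p q ≤ (S.card : ℤ) ^ 2 := by
  have h : ∑ p ∈ S, ∑ q ∈ S, 2 * adjZ p q ≤
      ∑ p ∈ S, ∑ q ∈ S, (1 - (Equiv.Perm.sign p : ℤ) * (Equiv.Perm.sign q : ℤ)) :=
    Finset.sum_le_sum fun p _ => Finset.sum_le_sum fun q _ => bip p q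
  simp_rw [Finset.sum_sub_distrib, ← Finset.mul_sum, ← Finset.sum_mul] at h
  simp at h
  nlinarith [sq_nonneg (∑ p ∈ S, (Equiv.Perm.sign p : ℤ))]

lemma adjB_adj {p q : Equiv.Perm (Fin 4)} (h : adjB p q = true) : (BS 4).Adj p q := by
  have hne : p ≠ q := by
    rintro rfl
    have : ∀ p, adjB p p = false := by decide +kernel
    simp [this] at h
  refine ⟨hne, Or.inl ?_⟩
  simp only [adjB, Bool.or_eq_true, beq_iff_eq] at h
  rcases h with (((h | h) | h) | h) | h
  · exact ⟨0, 1, by decide, by decide, h⟩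
  · exact ⟨0, 2, by decide, by decide, h⟩
  · exact ⟨0, 3, by decide, by decide, h⟩
  · exact ⟨1, 2, by decide, by decide, h⟩
  · exact ⟨2, 3, by decide, by decide, h⟩

lemma cut_le (F : Set (Sym2 (Equiv.Perm (Fin 4)))) (S : Finset (Equiv.Perm (Fin 4)))
    (hS : ∀ x ∈ S, ∀ y, ((BS 4).deleteEdges F).Adj x y → y ∈ S) :
    5 * (S.card : ℤ) - ∑ p ∈ S, ∑ q ∈ S, adjZ p q ≤ F.ncard := by
  classical
  have h1 : ∑ p ∈ S, ∑ q, adjZ p q = 5 * (S.card : ℤ) := by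
    simp [row_sum, mul_comm]
  have h2 : ∑ p ∈ S, ∑ q, adjZ p q
      = ∑ p ∈ S, ∑ q ∈ S, adjZ p q + ∑ p ∈ S, ∑ q ∈ Sᶜ, adjZ p q := by
    rw [← Finset.sum_add_distrib]
    exact Finset.sum_congr rfl fun p _ => (Finset.sum_add_sum_compl S _).symm
  have h3 : ∑ p ∈ S, ∑ q ∈ Sᶜ, adjZ p q
      = (((S ×ˢ Sᶜ).filter fun t => adjB t.1 t.2 = true).card : ℤ) := by
    rw [← Finset.sum_product', Finset.card_filter]
    push_cast
    rfl
  have h4 : ((S ×ˢ Sᶜ).filter fun t => adjB t.1 t.2 = true).card ≤ F.ncard := by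
    rw [← Set.ncard_coe_finset]
    refine Set.ncard_le_ncard_of_injOn (fun t => s(t.1, t.2)) ?_ ?_ (Set.toFinite F)
    · rintro ⟨x, y⟩ h
      simp only [Finset.coe_filter, Finset.mem_product, Finset.mem_compl,
        Set.mem_ofPred_eq] at h
      by_contra hF
      exact h.1.2 (hS x h.1.1 y (by
        rw [SimpleGraph.deleteEdges_adj]
        exact ⟨adjB_adj h.2, hF⟩))
    · rintro ⟨x, y⟩ h ⟨z, w⟩ h' e
      simp only [Finset.coe_filter, Finset.mem_product, Finset.mem_compl,
        Set.mem_ofPred_eq] at h h'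
      simp only [Sym2.eq_iff] at e
      rcases e with ⟨rfl, rfl⟩ | ⟨rfl, rfl⟩
      · rfl
      · exact absurd h.1.1 h'.1.2
  have : (((S ×ˢ Sᶜ).filter fun t => adjB t.1 t.2 = true).card : ℤ) ≤ F.ncard := by
    exact_mod_cast h4
  linarith

lemma closed_card (F : Set (Sym2 (Equiv.Perm (Fin 4)))) (hcard : F.ncard ≤ 10)
    (S : Finset (Equiv.Perm (Fin 4)))
    (hS : ∀ x ∈ S, ∀ y, ((BS 4).deleteEdges F).Adj x y → y ∈ S)
    (h3 : 3 ≤ S.card) (h21 : S.card ≤ 21) : False := by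
  classical
  have hS' : ∀ x ∈ Sᶜ, ∀ y, ((BS 4).deleteEdges F).Adj x y → y ∈ Sᶜ := by
    intro x hx y hxy
    rw [Finset.mem_compl] at hx ⊢
    exact fun hy => hx (hS y hy x hxy.symm)
  have c : Sᶜ.card = 24 - S.card := by
    rw [Finset.card_compl, Fintype.card_perm, Fintype.card_fin]
    rfl
  have a1 := cut_le F S hS
  have a2 := cut_le F _ hS'
  have b1 := inner_spectral S
  have d1 := inner_mantel S
  have d2 := inner_mantel Sᶜ
  rw [c] at a2 d2
  generalize ∑ p ∈ S, ∑ q ∈ S, adjZ p q = X at *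
  generalize ∑ p ∈ Sᶜ, ∑ q ∈ Sᶜ, adjZ p q = Y at *
  have hc : (F.ncard : ℤ) ≤ 10 := by exact_mod_cast hcard
  generalize S.card = k at *
  interval_cases k <;> norm_num at * <;> omega

/-- If at most `10` edges are deleted from `BS_4` and the result is disconnected, then it
has a connected component with at least `4! - 2 = 22` vertices. -/
theorem BS4_big_component_ten (F : Set (Sym2 (Equiv.Perm (Fin 4))))
    (hF : F ⊆ (BS 4).edgeSet) (hcard : F.ncard ≤ 10)
    (hdisc : ¬ ((BS 4).deleteEdges F).Connected) :
    ∃ C : ((BS 4).deleteEdges F).ConnectedComponent, 22 ≤ C.supp.ncard := by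
  classical
  by_contra! hcon
  set H := (BS 4).deleteEdges F with hH
  -- a largest closed set with at most 21 vertices
  let T : Finset (Finset (Equiv.Perm (Fin 4))) :=
    Finset.univ.filter fun S => (∀ x ∈ S, ∀ y, H.Adj x y → y ∈ S) ∧ S.card ≤ 21
  have hT : T.Nonempty := ⟨∅, by simp [T]⟩
  obtain ⟨S, hST, hmax⟩ := T.exists_max_image Finset.card hT
  obtain ⟨hS, h21⟩ := (Finset.mem_filter.1 hST).2
  by_cases h3 : 3 ≤ S.card
  · exact closed_card F hcard S hS h3 h21
  obtain ⟨x, hx⟩ : ∃ x, x ∉ S := by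
    by_contra! hall
    have : S = Finset.univ := Finset.eq_univ_iff_forall.2 hall
    rw [this, Finset.card_univ, Fintype.card_perm, Fintype.card_fin] at h21
    revert h21
    decide
  let C : Finset (Equiv.Perm (Fin 4)) := (H.connectedComponentMk x).supp.toFinset
  have hCc : C.card < 22 := by
    have := hcon (H.connectedComponentMk x)
    rwa [Set.ncard_eq_toFinset_card'] at this
  have hmem : ∀ y, y ∈ C ↔ H.Reachable y x := by
    intro y
    simp [C]
  have hC : ∀ y ∈ C, ∀ z, H.Adj y z → z ∈ C := by
    intro y hy z hyz
    rw [hmem] at hy ⊢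
    exact hyz.symm.reachable.trans hy
  have hxC : x ∈ C := (hmem x).2 (SimpleGraph.Reachable.refl x)
  have m1 : C.card ≤ S.card :=
    hmax C (Finset.mem_filter.2 ⟨Finset.mem_univ _, hC, by omega⟩)
  have u : (S ∪ C).card ≤ S.card + C.card := Finset.card_union_le _ _
  have m2 : (S ∪ C).card ≤ S.card := by
    refine hmax _ (Finset.mem_filter.2 ⟨Finset.mem_univ _, ?_, by omega⟩)
    intro y hy z hyz
    rw [Finset.mem_union] at hy ⊢
    exact hy.imp (fun h => hS y h z hyz) (fun h => hC y h z hyz)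
  have : S = S ∪ C := Finset.eq_of_subset_of_card_le Finset.subset_union_left m2
  exact hx (this ▸ Finset.mem_union_right _ hxC)
end

section
/- Let n ≥ 3 and F_e ⊆ E(BS_n) with |F_e| ≤ 6n − 14. If BS_n − F_e is disconnected, then BS_n − F_e has a connected component H with |V(H)| ≥ n! − 2. -/
open SimpleGraph

namespace BSProof

open Equiv Finset

/-- The generating transpositions. -/
noncomputable def T (n : ℕ) : Finset (Perm (Fin n)) := by
  classical
  exact univ.filter (fun g => ∃ i j : Fin n, (j.val = i.val + 1 ∨ i.val = 0) ∧ i ≠ j ∧ g = swap i j)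

lemma mem_T {n : ℕ} {g : Perm (Fin n)} : g ∈ T n ↔
    ∃ i j : Fin n, (j.val = i.val + 1 ∨ i.val = 0) ∧ i ≠ j ∧ g = swap i j := by
  simp [T]

/-- Number of `g`-coloured edges leaving `S`. -/
def ecut {n : ℕ} (g : Perm (Fin n)) (S : Finset (Perm (Fin n))) : ℕ :=
  (univ.filter (fun x => x ∈ S ∧ x * g ∉ S)).card

/-- Number of edges leaving `S`. -/
noncomputable def cut {n : ℕ} (S : Finset (Perm (Fin n))) : ℕ := ∑ g ∈ T n, ecut g S

/-- Embedding of permutations fixing the last position. -/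
noncomputable def emb (m : ℕ) : Perm (Fin m) →* Perm (Fin (m + 1)) :=
  Perm.viaEmbeddingHom Fin.castSuccEmb

lemma emb_castSucc {m : ℕ} (s : Perm (Fin m)) (i : Fin m) :
    emb m s i.castSucc = (s i).castSucc :=
  Perm.viaEmbedding_apply s Fin.castSuccEmb i

lemma emb_last {m : ℕ} (s : Perm (Fin m)) : emb m s (Fin.last m) = Fin.last m := by
  apply Perm.viaEmbedding_apply_of_notMem s Fin.castSuccEmb
  rintro ⟨x, hx⟩
  exact (Fin.castSucc_lt_last x).ne hx

lemma emb_inj (m : ℕ) : Function.Injective (emb m) := Perm.viaEmbeddingHom_injective _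

lemma emb_swap {m : ℕ} (i j : Fin m) : emb m (swap i j) = swap i.castSucc j.castSucc := by
  ext x
  congr 1
  refine Fin.lastCases ?_ (fun y => ?_) x
  · rw [emb_last, swap_apply_of_ne_of_ne (Fin.castSucc_lt_last i).ne' (Fin.castSucc_lt_last j).ne']
  · rw [emb_castSucc]
    simp only [swap_apply_def, Fin.castSucc_inj]
    split_ifs <;> rfl

/-- Parametrisation of all permutations by the last value and the rest. -/
noncomputable def Phi {m : ℕ} (i : Fin (m + 1)) (s : Perm (Fin m)) : Perm (Fin (m + 1)) :=
  swap i (Fin.last m) * emb m s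

lemma Phi_last {m : ℕ} (i : Fin (m + 1)) (s : Perm (Fin m)) : Phi i s (Fin.last m) = i := by
  simp [Phi, emb_last]

lemma Phi_mul {m : ℕ} (i : Fin (m + 1)) (s g : Perm (Fin m)) :
    Phi i s * emb m g = Phi i (s * g) := by
  simp [Phi, mul_assoc]

lemma Phi_bij (m : ℕ) : Function.Bijective
    (fun q : Fin (m + 1) × Perm (Fin m) => Phi q.1 q.2) := by
  rw [Fintype.bijective_iff_injective_and_card]
  constructor
  · rintro ⟨i, s⟩ ⟨j, t⟩ h
    simp only at h
    have h1 : i = j := by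
      have := congrArg (fun f => f (Fin.last m)) h
      simpa [Phi_last] using this
    subst h1
    have : s = t := emb_inj m (mul_left_cancel h)
    rw [this]
  · simp [Fintype.card_perm, Nat.factorial_succ]

lemma card_split {m : ℕ} (P : Perm (Fin (m + 1)) → Prop) [DecidablePred P] :
    (univ.filter P).card = ∑ i, (univ.filter (fun s => P (Phi i s))).card := by
  classical
  rw [← Finset.card_sigma]
  symm
  apply Finset.card_bij (fun q _ => Phi q.1 q.2)
  · rintro ⟨i, s⟩ h
    simpa using h
  · rintro ⟨i, s⟩ _ ⟨j, t⟩ _ h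
    have := (Phi_bij m).1 (a₁ := (i, s)) (a₂ := (j, t)) h
    simp only [Prod.mk.injEq] at this
    rw [this.1, this.2]
  · intro x hx
    obtain ⟨⟨i, s⟩, h⟩ := (Phi_bij m).2 x
    simp only at h
    refine ⟨⟨i, s⟩, ?_, h⟩
    simpa [h] using hx

/-- Sections. -/
noncomputable def sec {m : ℕ} (S : Finset (Perm (Fin (m + 1)))) (i : Fin (m + 1)) :
    Finset (Perm (Fin m)) := univ.filter (fun s => Phi i s ∈ S)

lemma mem_sec {m : ℕ} (S : Finset (Perm (Fin (m + 1)))) (i : Fin (m + 1)) (s) :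
    s ∈ sec S i ↔ Phi i s ∈ S := by simp [sec]

lemma sec_compl {m : ℕ} (S : Finset (Perm (Fin (m + 1)))) (i : Fin (m + 1)) :
    sec Sᶜ i = (sec S i)ᶜ := by
  ext s; simp [mem_sec]

lemma card_sec {m : ℕ} (S : Finset (Perm (Fin (m + 1)))) (J : Finset (Fin (m + 1))) :
    (univ.filter (fun x => x ∈ S ∧ x (Fin.last m) ∈ J)).card = ∑ j ∈ J, (sec S j).card := by
  classical
  rw [card_split, ← Finset.sum_subset (Finset.subset_univ J)]
  · apply Finset.sum_congr rfl
    intro j hj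
    simp [Phi_last, hj, sec]
  · intro j _ hj
    simp [Phi_last, hj]

lemma card_sec_univ {m : ℕ} (S : Finset (Perm (Fin (m + 1)))) :
    S.card = ∑ j, (sec S j).card := by
  rw [← card_sec]; simp

lemma ecut_emb {m : ℕ} (g : Perm (Fin m)) (S : Finset (Perm (Fin (m + 1)))) :
    ecut (emb m g) S = ∑ i, ecut g (sec S i) := by
  unfold ecut
  rw [card_split]
  simp [Phi_mul, mem_sec]

lemma ecut_compl {n : ℕ} (g : Perm (Fin n)) (hg : g * g = 1) (S : Finset (Perm (Fin n))) :
    ecut g Sᶜ = ecut g S := by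
  unfold ecut
  apply Finset.card_bij (fun x _ => x * g)
  · intro x hx
    simp [mul_assoc, hg] at hx ⊢
    tauto
  · intro x _ y _ h
    exact mul_right_cancel h
  · intro x hx
    refine ⟨x * g, ?_, by simp [mul_assoc, hg]⟩
    simp [mul_assoc, hg] at hx ⊢
    tauto

lemma T_sq {n : ℕ} {g : Perm (Fin n)} (h : g ∈ T n) : g * g = 1 := by
  obtain ⟨i, j, _, _, rfl⟩ := mem_T.1 h
  simp

lemma T_sign {n : ℕ} {g : Perm (Fin n)} (h : g ∈ T n) : Perm.sign g = -1 := by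
  obtain ⟨i, j, _, hij, rfl⟩ := mem_T.1 h
  exact Perm.sign_swap hij

lemma cut_compl {n : ℕ} (S : Finset (Perm (Fin n))) : cut Sᶜ = cut S :=
  Finset.sum_congr rfl fun _ hg => ecut_compl _ (T_sq hg) S

/-- first and penultimate positions -/
def p0 (m : ℕ) (hm : 3 ≤ m) : Fin m := ⟨0, by omega⟩
def p1 (m : ℕ) (hm : 3 ≤ m) : Fin m := ⟨m - 1, by omega⟩

/-- The two external generators -/
def ext (m : ℕ) (p : Fin m) : Perm (Fin (m + 1)) := swap p.castSucc (Fin.last m)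

lemma ext_sq {m : ℕ} (p : Fin m) : ext m p * ext m p = 1 := by simp [ext]

lemma ext_apply_last {m : ℕ} (p : Fin m) : ext m p (Fin.last m) = p.castSucc := by simp [ext]
lemma ext_apply {m : ℕ} (p : Fin m) : ext m p p.castSucc = Fin.last m := by simp [ext]

lemma ext_ne_emb {m : ℕ} (p : Fin m) (s : Perm (Fin m)) : emb m s ≠ ext m p := by
  intro h
  have := congrArg (fun f => f (Fin.last m)) h
  simp only [emb_last, ext_apply_last] at this
  exact (Fin.castSucc_lt_last p).ne' this

lemma ext_ne {m : ℕ} (hm : 3 ≤ m) : ext m (p0 m hm) ≠ ext m (p1 m hm) := by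
  intro h
  have := congrArg (fun f => f (Fin.last m)) h
  simp only [ext_apply_last, p0, p1, Fin.ext_iff, Fin.val_castSucc] at this
  omega

lemma T_step {m : ℕ} (hm : 3 ≤ m) :
    insert (ext m (p0 m hm)) (insert (ext m (p1 m hm)) ((T m).map ⟨emb m, emb_inj m⟩))
      ⊆ T (m + 1) := by
  intro g hg
  simp only [Finset.mem_insert, Finset.mem_map, Function.Embedding.coeFn_mk] at hg
  rw [mem_T]
  rcases hg with rfl | rfl | ⟨s, hs, rfl⟩
  · exact ⟨_, _, Or.inr (by simp [p0]), (Fin.castSucc_lt_last _).ne, rfl⟩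
  · exact ⟨_, _, Or.inl (by simp [p1]; omega), (Fin.castSucc_lt_last _).ne, rfl⟩
  · obtain ⟨i, j, h, hij, rfl⟩ := mem_T.1 hs
    refine ⟨i.castSucc, j.castSucc, by simpa using h, ?_, emb_swap i j⟩
    simpa using hij

lemma sum_T_step {m : ℕ} (hm : 3 ≤ m) (f : Perm (Fin (m + 1)) → ℕ) :
    f (ext m (p0 m hm)) + (f (ext m (p1 m hm)) + ∑ g ∈ T m, f (emb m g)) ≤
      ∑ g ∈ T (m + 1), f g := by
  refine le_trans (le_of_eq ?_) (Finset.sum_le_sum_of_subset (T_step hm))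
  rw [Finset.sum_insert, Finset.sum_insert, Finset.sum_map]
  · rfl
  · simp only [Finset.mem_map, Function.Embedding.coeFn_mk, not_exists, not_and]
    exact fun s _ => ext_ne_emb _ s
  · simp only [Finset.mem_insert, Finset.mem_map, Function.Embedding.coeFn_mk, not_or, not_exists,
      not_and]
    exact ⟨ext_ne hm, fun s _ => ext_ne_emb _ s⟩

lemma card_T {n : ℕ} (hn : 3 ≤ n) : 2 * n ≤ (T n).card + 3 := by
  induction n, hn using Nat.le_induction with
  | base =>
    have : ({swap 0 1, swap 0 2, swap 1 2} : Finset (Perm (Fin 3))) ⊆ T 3 := by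
      intro g hg
      simp only [Finset.mem_insert, Finset.mem_singleton] at hg
      rw [mem_T]
      rcases hg with rfl | rfl | rfl
      · exact ⟨0, 1, by simp, by decide, rfl⟩
      · exact ⟨0, 2, by simp, by decide, rfl⟩
      · exact ⟨1, 2, by simp, by decide, rfl⟩
    have h2 := Finset.card_le_card this
    have h3 : ({swap 0 1, swap 0 2, swap 1 2} : Finset (Perm (Fin 3))).card = 3 := by decide
    omega
  | succ m hm ih =>
    have := sum_T_step hm (fun _ => 1)
    simp at this
    omega

lemma cut_step {m : ℕ} (hm : 3 ≤ m) (S : Finset (Perm (Fin (m + 1)))) :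
    ecut (ext m (p0 m hm)) S + ecut (ext m (p1 m hm)) S + ∑ i, cut (sec S i) ≤ cut S := by
  have := sum_T_step hm (fun g => ecut g S)
  simp only [ecut_emb] at this
  rw [Finset.sum_comm] at this
  unfold cut
  omega

/-- Small sets. -/
lemma cut_small {n : ℕ} (S : Finset (Perm (Fin n))) :
    2 * (S.card * (T n).card) ≤ 2 * cut S + S.card * S.card := by
  classical
  set A := S.filter (fun x => Perm.sign x = 1) with hA
  set B := S.filter (fun x => ¬ Perm.sign x = 1) with hB
  have hAB : A.card + B.card = S.card := Finset.card_filter_add_card_filter_not _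
  have hcut : cut S = ∑ x ∈ S, ((T n).filter (fun g => x * g ∉ S)).card := by
    unfold cut ecut
    simp only [Finset.card_filter]
    rw [Finset.sum_comm, ← Finset.sum_subset (Finset.subset_univ S)]
    · apply Finset.sum_congr rfl
      intro x hx
      simp [hx]
    · intro x _ hx
      simp [hx]
  have key : ∀ (x : Perm (Fin n)) (D : Finset (Perm (Fin n))),
      (∀ g ∈ T n, x * g ∈ S → x * g ∈ D) →
      (T n).card ≤ ((T n).filter (fun g => x * g ∉ S)).card + D.card := by
    intro x D h
    have h1 : ((T n).filter (fun g => x * g ∈ S)).card ≤ D.card := by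
      apply Finset.card_le_card_of_injOn (fun g => x * g)
      · intro g hg
        simp only [Finset.coe_filter, Set.mem_ofPred_eq] at hg
        exact h g hg.1 hg.2
      · intro g _ g' _ h
        exact mul_left_cancel h
    have h2 := Finset.card_filter_add_card_filter_not (s := T n) (fun g => x * g ∈ S)
    omega
  have hsplit : cut S = ∑ x ∈ A, ((T n).filter (fun g => x * g ∉ S)).card +
      ∑ x ∈ B, ((T n).filter (fun g => x * g ∉ S)).card := by
    rw [hcut, hA, hB, Finset.sum_filter_add_sum_filter_not]
  have h1 : A.card * (T n).card ≤
      ∑ x ∈ A, ((T n).filter (fun g => x * g ∉ S)).card + A.card * B.card := by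
    rw [← smul_eq_mul, ← smul_eq_mul (A.card) B.card, ← Finset.sum_const, ← Finset.sum_const,
      ← Finset.sum_add_distrib]
    apply Finset.sum_le_sum
    intro x hx
    apply key
    intro g hg hxg
    simp only [hA, hB, Finset.mem_filter] at hx ⊢
    refine ⟨hxg, ?_⟩
    rw [Perm.sign_mul, T_sign hg, hx.2]
    decide
  have h2 : B.card * (T n).card ≤
      ∑ x ∈ B, ((T n).filter (fun g => x * g ∉ S)).card + B.card * A.card := by
    rw [← smul_eq_mul, ← smul_eq_mul (B.card) A.card, ← Finset.sum_const, ← Finset.sum_const,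
      ← Finset.sum_add_distrib]
    apply Finset.sum_le_sum
    intro x hx
    apply key
    intro g hg hxg
    simp only [hA, hB, Finset.mem_filter] at hx ⊢
    refine ⟨hxg, ?_⟩
    rw [Perm.sign_mul, T_sign hg]
    rcases Int.units_eq_one_or (Perm.sign x) with h | h
    · exact absurd h hx.2
    · rw [h]; decide
  rw [← hAB]
  have h3 : (2 : ℤ) * (A.card * B.card) * 2 ≤ (A.card + B.card) * (A.card + B.card) := by
    nlinarith [sq_nonneg ((A.card : ℤ) - B.card)]
  have h4 : 2 * (A.card * B.card) * 2 ≤ (A.card + B.card) * (A.card + B.card) := by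
    exact_mod_cast h3
  nlinarith

/-- Outgoing edges of one copy. -/
lemma E1 {m : ℕ} (p : Fin m) (S : Finset (Perm (Fin (m + 1)))) (i : Fin (m + 1)) :
    (sec S i).card ≤ ecut (ext m p) S + ∑ j ∈ univ.erase i, (sec S j).card := by
  classical
  have h1 := card_sec S {i}
  rw [Finset.sum_singleton] at h1
  rw [← h1, ← card_sec]
  have h2 : (univ.filter (fun x => x ∈ S ∧ x (Fin.last m) ∈ ({i} : Finset (Fin (m + 1))))) ⊆
      (univ.filter (fun x => x ∈ S ∧ x * ext m p ∉ S)) ∪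
      (univ.filter (fun y => y ∈ S ∧ y (Fin.last m) ∈ univ.erase i)).image (fun y => y * ext m p) := by
    intro x hx
    simp only [Finset.mem_filter, Finset.mem_univ, true_and, Finset.mem_singleton] at hx
    by_cases h : x * ext m p ∈ S
    · apply Finset.mem_union_right
      rw [Finset.mem_image]
      refine ⟨x * ext m p, ?_, by simp [mul_assoc, ext_sq]⟩
      simp only [Finset.mem_filter, Finset.mem_univ, true_and, Finset.mem_erase, and_true, h,
        Perm.mul_apply, ext_apply_last]
      rw [← hx.2]
      exact fun h => (Fin.castSucc_lt_last p).ne (x.injective h)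
    · apply Finset.mem_union_left
      simp [hx.1, h]
  exact (Finset.card_le_card h2).trans ((Finset.card_union_le _ _).trans
    (Nat.add_le_add_left Finset.card_image_le _))

lemma card_fix {m : ℕ} (p k : Fin m) :
    (univ.filter (fun s : Perm (Fin m) => s p = k)).card = (m - 1).factorial := by
  classical
  have hm : 0 < m := lt_of_le_of_lt (Nat.zero_le _) p.2
  have h : ∀ k', (univ.filter (fun s : Perm (Fin m) => s p = k')).card =
      (univ.filter (fun s : Perm (Fin m) => s p = k)).card := by
    intro k'
    apply Finset.card_bij (fun s _ => swap k' k * s)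
    · intro s hs
      simp at hs ⊢
      simp [hs]
    · intro s _ t _ h
      exact mul_left_cancel h
    · intro s hs
      refine ⟨swap k' k * s, ?_, by simp [← mul_assoc]⟩
      simp at hs ⊢
      simp [hs]
  have h2 := Finset.card_eq_sum_card_fiberwise (s := (univ : Finset (Perm (Fin m))))
    (t := (univ : Finset (Fin m))) (f := fun s => s p) (fun _ _ => by simp)
  rw [Finset.sum_congr rfl (fun k' _ => h k')] at h2
  simp [Fintype.card_perm] at h2
  rw [← Nat.mul_factorial_pred hm.ne'] at h2
  exact (Nat.eq_of_mul_eq_mul_left hm h2).symm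

lemma card_link {m : ℕ} (p : Fin m) (H L : Finset (Fin (m + 1))) (hd : Disjoint H L) :
    (univ.filter (fun x : Perm (Fin (m + 1)) => x (Fin.last m) ∈ H ∧ x p.castSucc ∈ L)).card
      = H.card * L.card * (m - 1).factorial := by
  classical
  rw [card_split, ← Finset.sum_subset (Finset.subset_univ H)]
  · rw [mul_assoc, ← smul_eq_mul (a := H.card), ← Finset.sum_const]
    apply Finset.sum_congr rfl
    intro i hi
    simp only [Phi_last, hi, true_and]
    rw [Finset.card_eq_sum_card_fiberwise (t := L) (f := fun s => Phi i s p.castSucc)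
      (fun s hs => by simpa using hs)]
    rw [← smul_eq_mul (a := L.card), ← Finset.sum_const]
    apply Finset.sum_congr rfl
    intro j hj
    have hij : i ≠ j := fun h => Finset.disjoint_left.1 hd hi (h ▸ hj)
    have hne : swap i (Fin.last m) j ≠ Fin.last m := by
      intro h
      apply hij
      have := congrArg (swap i (Fin.last m)) h
      simpa using this.symm
    obtain ⟨k, hk⟩ := Fin.exists_castSucc_eq.2 hne
    rw [← card_fix p k]
    congr 1
    ext s
    simp only [Finset.mem_filter, Finset.mem_univ, true_and]
    have : Phi i s p.castSucc = j ↔ s p = k := by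
      rw [Phi, Perm.mul_apply, emb_castSucc, ← Fin.castSucc_inj (a := s p), hk]
      constructor
      · intro h; rw [← h]; simp
      · intro h; rw [h]; simp
    rw [this]
    constructor
    · exact fun h => h.2
    · intro h
      exact ⟨by rw [this.2 h]; exact hj, h⟩
  · intro j _ hj
    simp [Phi_last, hj]

lemma E2 {m : ℕ} (p : Fin m) (S : Finset (Perm (Fin (m + 1)))) (H L : Finset (Fin (m + 1)))
    (hd : Disjoint H L) :
    H.card * L.card * (m - 1).factorial ≤
      ecut (ext m p) S + ∑ i ∈ H, (sec Sᶜ i).card + ∑ j ∈ L, (sec S j).card := by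
  classical
  rw [← card_link p H L hd, ← card_sec, ← card_sec]
  have h2 : (univ.filter (fun x : Perm (Fin (m + 1)) => x (Fin.last m) ∈ H ∧ x p.castSucc ∈ L)) ⊆
      ((univ.filter (fun x => x ∈ S ∧ x * ext m p ∉ S)) ∪
      (univ.filter (fun y => y ∈ Sᶜ ∧ y (Fin.last m) ∈ H))) ∪
      (univ.filter (fun y => y ∈ S ∧ y (Fin.last m) ∈ L)).image (fun y => y * ext m p) := by
    intro x hx
    simp only [Finset.mem_filter, Finset.mem_univ, true_and] at hx
    by_cases hxS : x ∈ S
    · by_cases h : x * ext m p ∈ S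
      · apply Finset.mem_union_right
        rw [Finset.mem_image]
        refine ⟨x * ext m p, ?_, by simp [mul_assoc, ext_sq]⟩
        simp [h, ext_apply_last, hx.2]
      · apply Finset.mem_union_left
        apply Finset.mem_union_left
        simp [hxS, h]
    · apply Finset.mem_union_left
      apply Finset.mem_union_right
      simp [hxS, hx.1]
  refine (Finset.card_le_card h2).trans ((Finset.card_union_le _ _).trans ?_)
  exact Nat.add_le_add (Finset.card_union_le _ _) Finset.card_image_le

/-- The numerical core of the induction step. `s`, `t`: sizes of the sections of `S` and of its
complement; `c`: the cuts inside the copies; `e`: the external cut; `C`: the total cut. -/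
lemma numeric_L (m : ℕ) (hm : 3 ≤ m) (s c : Fin (m + 1) → ℕ) (C : ℕ)
    (hC : ∑ i, c i ≤ C)
    (hc : ∀ i, s i ≤ 2 → s i ≠ 0 → 2 * m - 3 ≤ c i)
    (hsmall : ∑ i, s i ≤ 6 → 6 * m ≤ C + 7)
    (hL : ∀ i, s i ≤ 2) : 6 * m ≤ C + 7 := by
  classical
  by_cases h6 : ∑ i, s i ≤ 6
  · exact hsmall h6
  set Z := univ.filter (fun i => s i ≠ 0) with hZ
  have h1 : ∑ i, s i ≤ Z.card * 2 := by
    rw [← Finset.sum_filter_ne_zero, ← smul_eq_mul, ← Finset.sum_const]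
    exact Finset.sum_le_sum fun i _ => hL i
  have h2 : Z.card * (2 * m - 3) ≤ ∑ i, c i := by
    rw [← smul_eq_mul, ← Finset.sum_const]
    refine le_trans (Finset.sum_le_sum fun i hi => ?_)
      (Finset.sum_le_sum_of_subset (Finset.subset_univ Z))
    exact hc i (hL i) (by simpa [hZ] using hi)
  have h3 : 4 * (2 * m - 3) ≤ Z.card * (2 * m - 3) := Nat.mul_le_mul_right _ (by omega)
  omega

lemma numeric_one (m : ℕ) (s c : Fin (m + 1) → ℕ) (C e : ℕ)
    (hC : e + ∑ i, c i ≤ C)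
    (hc : ∀ i, s i ≤ 2 → 2 * s i ≤ c i)
    (b : Fin (m + 1)) (hb : 3 ≤ s b) (hcb : 6 * m ≤ c b + 13)
    (hE1 : 2 * s b ≤ e + 2 * ∑ j ∈ univ.erase b, s j)
    (hL : ∀ i, i ≠ b → s i ≤ 2) : 6 * m ≤ C + 7 := by
  classical
  rw [← Finset.add_sum_erase univ c (Finset.mem_univ b)] at hC
  have h1 : 2 * ∑ j ∈ univ.erase b, s j ≤ ∑ j ∈ univ.erase b, c j := by
    rw [Finset.mul_sum]
    exact Finset.sum_le_sum fun i hi => hc i (hL i (Finset.ne_of_mem_erase hi))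
  omega

lemma numeric (m : ℕ) (hm : 3 ≤ m) (s t c : Fin (m + 1) → ℕ) (C e : ℕ)
    (hst : ∀ i, s i + t i = m.factorial)
    (hC : e + ∑ i, c i ≤ C)
    (hc3 : ∀ i, 3 ≤ s i → 3 ≤ t i → 6 * m ≤ c i + 13)
    (hcs : ∀ i, s i ≤ 2 → s i ≠ 0 → 2 * m - 3 ≤ c i)
    (hct : ∀ i, t i ≤ 2 → t i ≠ 0 → 2 * m - 3 ≤ c i)
    (hcs2 : ∀ i, s i ≤ 2 → 2 * s i ≤ c i)
    (hct2 : ∀ i, t i ≤ 2 → 2 * t i ≤ c i)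
    (hsmalls : ∑ i, s i ≤ 6 → 6 * m ≤ C + 7)
    (hsmallt : ∑ i, t i ≤ 6 → 6 * m ≤ C + 7)
    (hE1s : ∀ b, 2 * s b ≤ e + 2 * ∑ j ∈ univ.erase b, s j)
    (hE1t : ∀ b, 2 * t b ≤ e + 2 * ∑ j ∈ univ.erase b, t j)
    (hE2 : ∀ H L : Finset (Fin (m + 1)), Disjoint H L →
      2 * (H.card * L.card * (m - 1).factorial) ≤ e + 2 * ∑ i ∈ H, t i + 2 * ∑ j ∈ L, s j) :
    6 * m ≤ C + 7 := by
  classical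
  have hN : 6 ≤ m.factorial := by
    have := Nat.factorial_le hm
    simpa [Nat.factorial] using this
  have hN1 : 2 ≤ (m - 1).factorial := by
    have := Nat.factorial_le (show 2 ≤ m - 1 by omega)
    simpa [Nat.factorial] using this
  set L := univ.filter (fun i => s i ≤ 2) with hLdef
  set H := univ.filter (fun i => t i ≤ 2) with hHdef
  have memL : ∀ i, i ∈ L ↔ s i ≤ 2 := by simp [hLdef]
  have memH : ∀ i, i ∈ H ↔ t i ≤ 2 := by simp [hHdef]
  have hd : Disjoint H L := by
    rw [Finset.disjoint_left]
    intro i h1 h2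
    rw [memH] at h1; rw [memL] at h2
    have := hst i
    omega
  have hHL : 2 * (H.card * L.card * (m - 1).factorial) ≤ e + ∑ i ∈ H ∪ L, c i := by
    rw [Finset.sum_union hd]
    have h1 := hE2 H L hd
    have h2 : 2 * ∑ j ∈ H, t j ≤ ∑ j ∈ H, c j := by
      rw [Finset.mul_sum]
      exact Finset.sum_le_sum fun i hi => hct2 i ((memH i).1 hi)
    have h3 : 2 * ∑ j ∈ L, s j ≤ ∑ j ∈ L, c j := by
      rw [Finset.mul_sum]
      exact Finset.sum_le_sum fun i hi => hcs2 i ((memL i).1 hi)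
    omega
  by_cases hB : ∃ b, 3 ≤ s b ∧ 3 ≤ t b
  · obtain ⟨b, hbs, hbt⟩ := hB
    have hcb := hc3 b hbs hbt
    by_cases hB2 : ∃ a, a ≠ b ∧ 3 ≤ s a ∧ 3 ≤ t a
    · obtain ⟨a, hab, has, hat⟩ := hB2
      have hca := hc3 a has hat
      have hsum2 : c a + c b ≤ ∑ i, c i := by
        rw [← Finset.sum_pair hab]
        exact Finset.sum_le_sum_of_subset (Finset.subset_univ _)
      by_cases hm4 : 4 ≤ m
      · omega
      obtain rfl : m = 3 := by omega
      have hf : Nat.factorial 3 = 6 := rfl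
      by_cases hD : ∃ d, d ≠ a ∧ d ≠ b ∧ s d ≠ 0 ∧ t d ≠ 0
      · obtain ⟨d, hda, hdb, hds, hdt⟩ := hD
        have hcd : 3 ≤ c d := by
          by_cases h1 : s d ≤ 2
          · have := hcs d h1 hds; omega
          · by_cases h2 : t d ≤ 2
            · have := hct d h2 hdt; omega
            · have := hc3 d (by omega) (by omega); omega
        have : c d + (c a + c b) ≤ ∑ i, c i := by
          rw [← Finset.sum_pair hab, ← Finset.sum_insert (by simp [hda, hdb])]
          exact Finset.sum_le_sum_of_subset (Finset.subset_univ _)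
        omega
      · push Not at hD
        have hsum : ∀ f : Fin (3 + 1) → ℕ, (∀ d, d ≠ a → d ≠ b → f d = 0) →
            ∑ i, f i = f a + f b := by
          intro f hf
          rw [← Finset.sum_pair hab]
          symm
          apply Finset.sum_subset (Finset.subset_univ _)
          intro x _ hx
          simp only [Finset.mem_insert, Finset.mem_singleton, not_or] at hx
          exact hf x hx.1 hx.2
        have ha := hst a
        have hb := hst b
        by_cases hx : ∃ x, x ≠ a ∧ x ≠ b ∧ s x ≠ 0
        · obtain ⟨x, hxa, hxb, hxs⟩ := hx
          by_cases hy : ∃ y, y ≠ a ∧ y ≠ b ∧ t y ≠ 0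
          · obtain ⟨y, hya, hyb, hyt⟩ := hy
            have hxt := hD x hxa hxb hxs
            have hys : s y = 0 := by
              by_contra h
              exact hyt (hD y hya hyb h)
            have hxy : x ≠ y := by
              rintro rfl
              exact hxs hys
            have := hE2 {x} {y} (by simpa using hxy)
            simp [hxt, hys] at this
            omega
          · push Not at hy
            apply hsmallt
            rw [hsum t hy]
            omega
        · push Not at hx
          apply hsmalls
          rw [hsum s hx]
          omega
    · push Not at hB2
      have hcover : ∀ i, i ≠ b → i ∈ H ∪ L := by
        intro i hi
        rw [Finset.mem_union, memH, memL]
        by_contra h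
        push Not at h
        have := hB2 i hi (by omega)
        omega
      have hbn : b ∉ H ∪ L := by
        rw [Finset.mem_union, memH, memL]
        omega
      have hUL : H ∪ L = univ.erase b := by
        ext i
        simp only [Finset.mem_erase, Finset.mem_univ, and_true]
        exact ⟨fun h h' => hbn (h' ▸ h), hcover i⟩
      by_cases hH : H = ∅
      · refine numeric_one m s c C e hC hcs2 b hbs hcb (hE1s b) fun i hi => ?_
        have := hcover i hi
        rw [hH, Finset.empty_union] at this
        exact (memL i).1 this
      by_cases hL : L = ∅
      · refine numeric_one m t c C e hC hct2 b hbt hcb (hE1t b) fun i hi => ?_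
        have := hcover i hi
        rw [hL, Finset.union_empty] at this
        exact (memH i).1 this
      have h1 := Finset.card_pos.2 (Finset.nonempty_iff_ne_empty.2 hH)
      have h2 := Finset.card_pos.2 (Finset.nonempty_iff_ne_empty.2 hL)
      have h3 : H.card + L.card = m := by
        rw [← Finset.card_union_of_disjoint hd, hUL, Finset.card_erase_of_mem (Finset.mem_univ b)]
        simp
      have h4 : 2 ≤ H.card * L.card := by nlinarith
      have h5 : 2 * 2 ≤ H.card * L.card * (m - 1).factorial := Nat.mul_le_mul h4 hN1
      rw [hUL] at hHL
      rw [← Finset.add_sum_erase univ c (Finset.mem_univ b)] at hC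
      omega
  · push Not at hB
    have hUL : H ∪ L = univ := by
      ext i
      simp only [Finset.mem_univ, iff_true]
      rw [Finset.mem_union, memH, memL]
      by_contra h
      push Not at h
      have := hB i (by omega)
      omega
    by_cases hH : H = ∅
    · refine numeric_L m hm s c C (by omega) hcs hsmalls fun i => ?_
      have := Finset.mem_univ i
      rw [← hUL, hH, Finset.empty_union] at this
      exact (memL i).1 this
    by_cases hL : L = ∅
    · refine numeric_L m hm t c C (by omega) hct hsmallt fun i => ?_
      have := Finset.mem_univ i
      rw [← hUL, hL, Finset.union_empty] at this
      exact (memH i).1 this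
    have h1 := Finset.card_pos.2 (Finset.nonempty_iff_ne_empty.2 hH)
    have h2 := Finset.card_pos.2 (Finset.nonempty_iff_ne_empty.2 hL)
    have h3 : H.card + L.card = m + 1 := by
      rw [← Finset.card_union_of_disjoint hd, hUL]
      simp
    have h4 : m ≤ H.card * L.card := by nlinarith
    rw [hUL] at hHL
    have h5 : m * (m - 1).factorial ≤ H.card * L.card * (m - 1).factorial :=
      Nat.mul_le_mul_right _ h4
    by_cases hm4 : 4 ≤ m
    · have h6 : 6 ≤ (m - 1).factorial := by
        have := Nat.factorial_le (show 3 ≤ m - 1 by omega)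
        simpa [Nat.factorial] using this
      have : m * 6 ≤ m * (m - 1).factorial := Nat.mul_le_mul_left _ h6
      omega
    · obtain rfl : m = 3 := by omega
      have hf : (3 - 1).factorial = 2 := rfl
      rw [hf] at h5 hHL
      omega

lemma small_six {n : ℕ} (hn : 4 ≤ n) (S : Finset (Perm (Fin n))) (h3 : 3 ≤ S.card)
    (h6 : S.card ≤ 6) : 6 * n ≤ cut S + 13 := by
  have h1 := cut_small S
  have h2 := card_T (show 3 ≤ n by omega)
  generalize S.card = k at *
  interval_cases k <;> omega

lemma small_one {n : ℕ} (hn : 3 ≤ n) (S : Finset (Perm (Fin n))) (h3 : S.card ≤ 2)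
    (h6 : S.card ≠ 0) : 2 * n - 3 ≤ cut S := by
  have h1 := cut_small S
  have h2 := card_T hn
  generalize S.card = k at *
  interval_cases k <;> omega

lemma small_two {n : ℕ} (hn : 3 ≤ n) (S : Finset (Perm (Fin n))) (h3 : S.card ≤ 2) :
    2 * S.card ≤ cut S := by
  have h1 := cut_small S
  have h2 := card_T hn
  generalize S.card = k at *
  interval_cases k <;> omega

theorem iso {n : ℕ} (hn : 3 ≤ n) (S : Finset (Perm (Fin n))) (h3 : 3 ≤ S.card)
    (hS : 3 ≤ Sᶜ.card) : 6 * n ≤ cut S + 13 := by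
  induction n, hn using Nat.le_induction with
  | base =>
    have h1 := cut_small S
    have h2 := card_T (show 3 ≤ 3 by omega)
    have h4 := Finset.card_add_card_compl S
    rw [Fintype.card_perm, Fintype.card_fin] at h4
    have h5 : Nat.factorial 3 = 6 := rfl
    have h6 : S.card = 3 := by omega
    rw [h6] at h1
    omega
  | succ m hm ih =>
    have hcc : ∀ i, cut (sec Sᶜ i) = cut (sec S i) := fun i => by rw [sec_compl, cut_compl]
    have key := numeric m hm (fun i => (sec S i).card) (fun i => (sec Sᶜ i).card)
      (fun i => cut (sec S i)) (cut S) (ecut (ext m (p0 m hm)) S + ecut (ext m (p1 m hm)) S)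
      (fun i => by
        simp only [sec_compl]
        rw [Finset.card_add_card_compl, Fintype.card_perm, Fintype.card_fin])
      (cut_step hm S)
      (fun i h1 h2 => ih _ h1 (by simpa [sec_compl] using h2))
      (fun i h1 h2 => small_one hm _ h1 h2)
      (fun i h1 h2 => by simpa only [hcc] using small_one hm _ h1 h2)
      (fun i h1 => small_two hm _ h1)
      (fun i h1 => by simpa only [hcc] using small_two hm _ h1)
      (fun h => by
        rw [← card_sec_univ] at h
        have := small_six (by omega) S h3 h
        omega)
      (fun h => by
        rw [← card_sec_univ] at h
        have := small_six (by omega) Sᶜ hS h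
        rw [cut_compl] at this
        omega)
      (fun b => by
        have h1 := E1 (p0 m hm) S b
        have h2 := E1 (p1 m hm) S b
        omega)
      (fun b => by
        have h1 := E1 (p0 m hm) Sᶜ b
        have h2 := E1 (p1 m hm) Sᶜ b
        rw [ecut_compl _ (ext_sq _)] at h1 h2
        omega)
      (fun H L hd => by
        have h1 := E2 (p0 m hm) S H L hd
        have h2 := E2 (p1 m hm) S H L hd
        omega)
    omega

/-- Counting lemma: generator edges at distinguished endpoints. -/
lemma count_F {n : ℕ} (F : Set (Sym2 (Perm (Fin n)))) (Q : Finset (Perm (Fin n) × Perm (Fin n)))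
    (hF : ∀ q ∈ Q, s(q.1, q.1 * q.2) ∈ F) (A : Set (Perm (Fin n)))
    (hA : ∀ q ∈ Q, q.1 ∈ A ∧ q.1 * q.2 ∉ A) : Q.card ≤ F.ncard := by
  rw [← Set.ncard_coe_finset]
  apply Set.ncard_le_ncard_of_injOn (fun q => s(q.1, q.1 * q.2)) hF _ (Set.toFinite F)
  rintro ⟨x, g⟩ hx ⟨y, h⟩ hy hxy
  have h1 := hA _ hx
  have h2 := hA _ hy
  simp only [Sym2.eq_iff] at hxy h1 h2
  rcases hxy with ⟨rfl, h⟩ | ⟨h, h'⟩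
  · rw [mul_left_cancel h]
  · rw [h] at h1
    exact absurd h1.1 h2.2

lemma adj_T {n : ℕ} (x g : Perm (Fin n)) (hg : g ∈ T n) : (BS n).Adj x (x * g) := by
  rw [BS, SimpleGraph.fromRel_adj]
  have hs := T_sign hg
  obtain ⟨i, j, h, hij, rfl⟩ := mem_T.1 hg
  refine ⟨?_, Or.inl ⟨i, j, h, hij, rfl⟩⟩
  intro h
  have := left_eq_mul.1 h
  rw [this] at hs
  simp at hs

end BSProof

/-- For `n ≥ 3`, if at most `6n - 14` edges are deleted from `BS_n` and the result is
disconnected, then it has a connected component with at least `n! - 2` vertices. -/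
theorem BS_big_component_two (n : ℕ) (hn : 3 ≤ n)
    (F : Set (Sym2 (Equiv.Perm (Fin n)))) (hF : F ⊆ (BS n).edgeSet)
    (hcard : F.ncard ≤ 6 * n - 14) (hdisc : ¬ ((BS n).deleteEdges F).Connected) :
    ∃ C : ((BS n).deleteEdges F).ConnectedComponent,
      n.factorial - 2 ≤ C.supp.ncard := by
  classical
  by_contra hcon
  push Not at hcon
  set G := (BS n).deleteEdges F with hG
  have hadj : ∀ x g, g ∈ BSProof.T n → s(x, x * g) ∉ F → G.Adj x (x * g) := by
    intro x g hg h
    rw [hG, SimpleGraph.deleteEdges_adj]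
    exact ⟨BSProof.adj_T x g hg, h⟩
  by_cases hbig : ∃ C : G.ConnectedComponent, 3 ≤ C.supp.ncard
  · obtain ⟨C, hC⟩ := hbig
    have hC2 := hcon C
    set S : Finset (Equiv.Perm (Fin n)) := C.supp.toFinset with hS
    have hmem : ∀ x, x ∈ S ↔ x ∈ C.supp := by simp [hS]
    have hSc : S.card = C.supp.ncard := by
      rw [hS, Set.ncard_eq_toFinset_card']
    have hcc := Finset.card_add_card_compl S
    rw [Fintype.card_perm, Fintype.card_fin] at hcc
    have key := BSProof.iso hn S (by omega) (by omega)
    have hle : BSProof.cut S ≤ F.ncard := by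
      have hcut : BSProof.cut S = ((Finset.univ ×ˢ BSProof.T n).filter
          (fun q : Equiv.Perm (Fin n) × Equiv.Perm (Fin n) => q.1 ∈ S ∧ q.1 * q.2 ∉ S)).card := by
        unfold BSProof.cut BSProof.ecut
        simp only [Finset.card_filter]
        rw [Finset.sum_product, Finset.sum_comm]
      rw [hcut]
      apply BSProof.count_F F _ _ (S : Set (Equiv.Perm (Fin n)))
      · intro q hq
        simp only [Finset.mem_filter, Finset.mem_product] at hq
        simpa using hq.2
      · intro q hq
        simp only [Finset.mem_filter, Finset.mem_product] at hq
        by_contra h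
        have ha := hadj q.1 q.2 hq.1.2 h
        apply hq.2.2
        rw [hmem]
        have h1 := (hmem _).1 hq.2.1
        rw [SimpleGraph.ConnectedComponent.mem_supp_iff] at h1 ⊢
        rw [← h1]
        exact SimpleGraph.ConnectedComponent.connectedComponentMk_eq_of_adj ha.symm
    omega
  · push Not at hbig
    have hone : ∀ x, (BSProof.T n).card ≤
        ((BSProof.T n).filter (fun g => s(x, x * g) ∈ F)).card + 1 := by
      intro x
      have h2 := Finset.card_filter_add_card_filter_not (s := BSProof.T n)
        (fun g => s(x, x * g) ∈ F)
      have h3 : ((BSProof.T n).filter (fun g => ¬ s(x, x * g) ∈ F)).card ≤ 1 := by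
        rw [Finset.card_le_one]
        intro g hg g' hg'
        by_contra hne
        simp only [Finset.mem_filter] at hg hg'
        have ha := hadj x g hg.1 hg.2
        have ha' := hadj x g' hg'.1 hg'.2
        have hb := hbig (G.connectedComponentMk x)
        have h4 : ({x, x * g, x * g'} : Finset (Equiv.Perm (Fin n))).card = 3 := by
          rw [Finset.card_eq_three]
          exact ⟨x, x * g, x * g', ha.ne, ha'.ne, fun h => hne (mul_left_cancel h), rfl⟩
        have h5 : (({x, x * g, x * g'} : Finset (Equiv.Perm (Fin n))) :
            Set (Equiv.Perm (Fin n))) ⊆ (G.connectedComponentMk x).supp := by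
          intro y hy
          simp only [Finset.coe_insert, Finset.coe_singleton, Set.mem_insert_iff,
            Set.mem_singleton_iff] at hy
          rw [SimpleGraph.ConnectedComponent.mem_supp_iff]
          rcases hy with rfl | rfl | rfl
          · rfl
          · exact SimpleGraph.ConnectedComponent.connectedComponentMk_eq_of_adj ha.symm
          · exact SimpleGraph.ConnectedComponent.connectedComponentMk_eq_of_adj ha'.symm
        have h6 := Set.ncard_le_ncard h5 (Set.toFinite _)
        rw [Set.ncard_coe_finset, h4] at h6
        omega
      omega
    set A : Finset (Equiv.Perm (Fin n)) :=
      Finset.univ.filter (fun x => Equiv.Perm.sign x = 1) with hA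
    have hA3 : 3 ≤ A.card := by
      have : Nontrivial (Fin n) := Fin.nontrivial_iff_two_le.2 (by omega)
      have h1 := two_mul_card_alternatingGroup (α := Fin n)
      rw [Fintype.card_perm, Fintype.card_fin] at h1
      have h2 : Fintype.card (alternatingGroup (Fin n)) = A.card := by
        rw [hA, Fintype.card_subtype]
        congr 1
        ext x
        simp [Equiv.Perm.mem_alternatingGroup]
      have h3 : 6 ≤ n.factorial := by
        have := Nat.factorial_le hn
        simpa [Nat.factorial] using this
      omega
    have hle : ((A ×ˢ BSProof.T n).filter
        (fun q : Equiv.Perm (Fin n) × Equiv.Perm (Fin n) => s(q.1, q.1 * q.2) ∈ F)).card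
          ≤ F.ncard := by
      apply BSProof.count_F F _ _ (A : Set (Equiv.Perm (Fin n)))
      · intro q hq
        simp only [Finset.mem_filter, Finset.mem_product] at hq
        refine ⟨hq.1.1, ?_⟩
        have h1 := hq.1.1
        simp only [hA, Finset.mem_filter, Finset.mem_univ, true_and, Finset.coe_filter,
          Set.mem_ofPred_eq] at h1 ⊢
        rw [Equiv.Perm.sign_mul, BSProof.T_sign hq.1.2, h1]
        decide
      · intro q hq
        simp only [Finset.mem_filter] at hq
        exact hq.2
    rw [Finset.card_filter, Finset.sum_product] at hle
    simp only [← Finset.card_filter] at hle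
    have h7 : A.card * ((BSProof.T n).card - 1) ≤ F.ncard := by
      refine le_trans ?_ hle
      rw [← smul_eq_mul, ← Finset.sum_const]
      apply Finset.sum_le_sum
      intro x _
      have := hone x
      omega
    have h8 : 3 * ((BSProof.T n).card - 1) ≤ A.card * ((BSProof.T n).card - 1) :=
      Nat.mul_le_mul_right _ hA3
    have h9 := BSProof.card_T hn
    omega
end

section
/- Let F_e ⊆ E(BS_4) with |F_e| ≤ 11. If BS_4 − F_e is disconnected, then BS_4 − F_e has a connected component H with at least 4! − 3 = 21 vertices. -/
open SimpleGraph

/-- The bit number `j` of `m`. -/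
def bsBit (m j : ℕ) : Bool := Nat.beq (Nat.land 1 (Nat.shiftRight m j)) 1

/-- Pay one unit of the budget for every `j` in `r` whose bit in `m` differs from `b`; stop with
`true` when the budget is exhausted, otherwise continue with the remaining budget. -/
noncomputable def bsSpend (m : ℕ) (b : Bool) (r : List ℕ) : ℕ → (ℕ → Bool) → Bool :=
  List.rec (fun n k => k n)
    (fun j _ ih n k => Bool.rec (ih n k)
      (Nat.rec true (fun n' _ => ih n' k) n) (Bool.xor (bsBit m j) b)) r

/-- Evaluate `n` before passing it on. -/
noncomputable def bsForce (n : ℕ) (k : ℕ → Bool) : Bool :=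
  Nat.rec (k 0) (fun n _ => k (Nat.succ n)) n

/-- Branch-and-bound search.  The list `rows` holds, for the vertices `i, i+1, …`, the neighbours
with smaller index; `m` is the bit mask of the part of the vertex set chosen so far among the
vertices `< i`, `n` the number of boundary edges still allowed, `size` the size of that part. -/
noncomputable def bsSearch (rows : List (List ℕ)) : ℕ → ℕ → ℕ → ℕ → Bool :=
  List.rec (fun _ _ _ size => Bool.or (Nat.ble size 3) (Nat.ble 21 size))
    (fun r _ ih i m n size =>
      Bool.and (bsSpend m false r n (fun n => ih (Nat.succ i) m n size))
        (bsSpend m true r n (fun n =>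
          bsForce (Nat.lor m (Nat.pow 2 i)) fun m => ih (Nat.succ i) m n (Nat.succ size)))) rows

theorem bsBit_eq (m j : ℕ) : bsBit m j = m.testBit j := by
  have h : (Nat.land 1 (Nat.shiftRight m j)) = 1 &&& (m >>> j) := rfl
  rw [bsBit, Nat.testBit, h, Nat.one_and_eq_mod_two]
  rcases Nat.mod_two_eq_zero_or_one (m >>> j) with h | h <;> rw [h] <;> rfl

theorem bsForce_eq (n : ℕ) (k : ℕ → Bool) : bsForce n k = k n := by
  cases n <;> rfl

theorem bsSpend_sound (m : ℕ) (b : Bool) (r : List ℕ) (k : ℕ → Bool) : ∀ n : ℕ,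
    bsSpend m b r n k = true → r.countP (fun j => m.testBit j != b) ≤ n →
    k (n - r.countP (fun j => m.testBit j != b)) = true := by
  induction r with
  | nil => intro n h _; exact h
  | cons j r ih =>
    intro n h hn
    have step : bsSpend m b (j :: r) n k = Bool.rec (bsSpend m b r n k)
      (Nat.rec true (fun n' _ => bsSpend m b r n' k) n) (Bool.xor (bsBit m j) b) := rfl
    rw [step, bsBit_eq] at h
    rw [List.countP_cons] at hn ⊢
    have hx : (m.testBit j != b) = Bool.xor (m.testBit j) b := rfl
    rw [hx] at hn ⊢
    cases hc : Bool.xor (m.testBit j) b with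
    | false =>
      rw [hc] at h hn
      simp only [Bool.false_eq_true, if_false, add_zero] at hn ⊢
      exact ih n h hn
    | true =>
      rw [hc] at h hn
      simp only [if_true] at hn ⊢
      cases n with
      | zero => omega
      | succ n =>
        have := ih n h (by omega)
        rwa [Nat.add_sub_add_right]

/-- The edges (larger index second) described by `rows`, starting with the vertex `i`. -/
def bsEdges : List (List ℕ) → ℕ → List (ℕ × ℕ)
  | [], _ => []
  | r :: rs, i => r.map (fun j => (j, i)) ++ bsEdges rs (i + 1)

/-- Every back neighbour has a smaller index. -/
def bsBack : List (List ℕ) → ℕ → Bool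
  | [], _ => true
  | r :: rs, i => r.all (fun j => decide (j < i)) && bsBack rs (i + 1)

theorem bsSearch_sound (f : ℕ → Bool) (rows : List (List ℕ)) : ∀ (i m n size : ℕ),
    bsBack rows i = true → (∀ j, m.testBit j = (decide (j < i) && f j)) →
    bsSearch rows i m n size = true →
    (bsEdges rows i).countP (fun e => f e.1 != f e.2) ≤ n →
    size + (List.range' i rows.length).countP f ≤ 3 ∨
      21 ≤ size + (List.range' i rows.length).countP f := by
  induction rows with
  | nil =>
    intro i m n size _ _ h _
    have h' : (Nat.ble size 3 || Nat.ble 21 size) = true := h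
    simpa using h'
  | cons r rs ih =>
    intro i m n size hb hm h hn
    simp only [bsBack, Bool.and_eq_true, List.all_eq_true, decide_eq_true_eq] at hb
    have step : bsSearch (r :: rs) i m n size =
      ((bsSpend m false r n (fun n => bsSearch rs (i + 1) m n size)) &&
        (bsSpend m true r n (fun n =>
          bsForce (m ||| 2 ^ i) fun m => bsSearch rs (i + 1) m n (size + 1)))) := rfl
    rw [step, Bool.and_eq_true] at h
    obtain ⟨h0, h1⟩ := h
    simp only [bsEdges, List.countP_append, List.countP_map] at hn
    simp only [List.length_cons, List.range'_succ, List.countP_cons]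
    have e : r.countP ((fun e : ℕ × ℕ => f e.1 != f e.2) ∘ fun j => (j, i)) =
        r.countP (fun j => m.testBit j != f i) := by
      apply List.countP_congr
      intro j hj
      simp [hm j, hb.1 j hj]
    rw [e] at hn
    cases hf : f i with
    | false =>
      rw [hf] at hn
      have h2 := bsSpend_sound m false r _ n h0 (by omega)
      have := ih (i + 1) m _ _ hb.2 (by
        intro j
        rw [hm j]
        by_cases hj : j = i
        · subst hj; simp [hf]
        · have : j < i + 1 ↔ j < i := by omega
          simp [this]) h2 (by omega)
      simp only [Bool.false_eq_true, if_false]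
      omega
    | true =>
      rw [hf] at hn
      have h2 := bsSpend_sound m true r _ n h1 (by omega)
      rw [bsForce_eq] at h2
      have := ih (i + 1) (m ||| 2 ^ i) _ _ hb.2 (by
        intro j
        rw [Nat.testBit_or, hm j, Nat.testBit_two_pow]
        by_cases hj : j = i
        · subst hj; simp [hf]
        · have h1 : j < i + 1 ↔ j < i := by omega
          have h2 : ¬ i = j := fun h => hj h.symm
          simp [h1, h2]) h2 (by omega)
      simp only [if_true]
      omega

/-- Smaller-index neighbours of the vertices `1, …, 23` of `BS 4` (vertex `0` has none). -/
def bsRows : List (List ℕ) :=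
  [[0], [], [1, 2], [1], [1, 2], [0, 4, 5], [0, 4, 5], [0, 3], [2, 6, 8], [2, 6], [5, 9, 10],
    [1, 8], [0, 3, 12], [7, 11], [4, 10, 14], [4, 12, 14], [7, 13, 15, 16], [3, 9], [13, 16,
    18], [10, 14, 19], [11, 15, 18, 20], [2, 8, 18, 20], [12, 17, 19, 21, 22]]

/-- The six permutations fixing the last position. -/
def bsInner : ℕ → Equiv.Perm (Fin 4)
  | 0 => 1
  | 1 => Equiv.swap 0 1
  | 2 => Equiv.swap 0 2
  | 3 => Equiv.swap 1 2
  | 4 => Equiv.swap 0 1 * Equiv.swap 1 2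
  | _ => Equiv.swap 1 2 * Equiv.swap 0 1

/-- The order in which the permutations are processed, chosen to keep the search small. -/
def bsOrder : List ℕ :=
  [5, 1, 9, 4, 16, 6, 8, 15, 3, 10, 11, 7, 0, 2, 17, 13, 14, 12, 22, 20, 23, 19, 21, 18]

/-- Enumeration of the 24 permutations. -/
def bsVert (i : ℕ) : Equiv.Perm (Fin 4) :=
  Equiv.swap (Fin.ofNat 4 (bsOrder.getD i 0 / 6)) 3 * bsInner (bsOrder.getD i 0 % 6)

theorem bsSearch_rows : bsSearch bsRows 1 1 11 1 = true := by decide +kernel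

theorem bsBack_rows : bsBack bsRows 1 = true := by decide +kernel

theorem bsVert_nodup : ((List.range 24).map bsVert).Nodup := by decide +kernel

theorem bsVert_all : ∀ x : Equiv.Perm (Fin 4), x ∈ (List.range 24).map bsVert := by
  decide +kernel

theorem bsEdges_nodup :
    ((bsEdges bsRows 1).map (fun e => s(bsVert e.1, bsVert e.2))).Nodup := by
  decide +kernel

theorem bsEdges_rel : ∀ e ∈ bsEdges bsRows 1, bsVert e.1 ≠ bsVert e.2 ∧
    ∃ i j : Fin 4, (j.val = i.val + 1 ∨ i.val = 0) ∧ i ≠ j ∧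
      bsVert e.2 = bsVert e.1 * Equiv.swap i j := by
  decide +kernel

theorem bsEdges_adj (e : ℕ × ℕ) (he : e ∈ bsEdges bsRows 1) :
    (BS 4).Adj (bsVert e.1) (bsVert e.2) := by
  rw [BS, SimpleGraph.fromRel_adj]
  exact ⟨(bsEdges_rel e he).1, Or.inl (bsEdges_rel e he).2⟩

/-- A set of vertices that contains vertex `0` and is closed under adjacency after deleting at
most 11 edges has at most 3 or at least 21 elements. -/
theorem bs_closed_card_aux (F : Set (Sym2 (Equiv.Perm (Fin 4)))) (hcard : F.ncard ≤ 11)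
    (T : Finset (Equiv.Perm (Fin 4))) (h0 : bsVert 0 ∈ T)
    (hT : ∀ x y, ((BS 4).deleteEdges F).Adj x y → (x ∈ T ↔ y ∈ T)) :
    T.card ≤ 3 ∨ 21 ≤ T.card := by
  have key := bsSearch_sound (fun i => decide (bsVert i ∈ T)) bsRows 1 1 11 1
    bsBack_rows (by
      intro j
      have h1 : (1 : ℕ).testBit j = decide (0 = j) := Nat.testBit_two_pow (n := 0)
      rw [h1]
      by_cases hj : j = 0
      · subst hj; simp [h0]
      · have h2 : ¬ 0 = j := fun h => hj h.symm
        have h3 : ¬ j < 1 := by omega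
        simp [h2, hj]) bsSearch_rows
  have hsize : 1 + (List.range' 1 bsRows.length).countP (fun i => decide (bsVert i ∈ T))
      = T.card := by
    have hr : List.range 24 = 0 :: List.range' 1 bsRows.length := by decide +kernel
    have h5 : (List.range 24).countP (fun i => decide (bsVert i ∈ T)) =
        1 + (List.range' 1 bsRows.length).countP (fun i => decide (bsVert i ∈ T)) := by
      rw [hr, List.countP_cons]
      simp [h0, add_comm]
    rw [← h5]
    have h1 : T = (((List.range 24).map bsVert).filter (fun x => decide (x ∈ T))).toFinset := by
      ext x
      rw [List.mem_toFinset, List.mem_filter]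
      simp only [bsVert_all x, true_and, decide_eq_true_eq]
    have h2 := congrArg Finset.card h1
    rw [List.toFinset_card_of_nodup (bsVert_nodup.filter _), ← List.countP_eq_length_filter,
      List.countP_map] at h2
    rw [h2]
    rfl
  rw [hsize] at key
  refine key ?_
  by_contra h12
  set E := (bsEdges bsRows 1).filter
    (fun e => decide (bsVert e.1 ∈ T) != decide (bsVert e.2 ∈ T)) with hE
  rw [List.countP_eq_length_filter, ← hE] at h12
  have hnd : (E.map (fun e => s(bsVert e.1, bsVert e.2))).Nodup :=
    bsEdges_nodup.sublist (List.filter_sublist.map _)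
  have hsub : ((E.map (fun e => s(bsVert e.1, bsVert e.2))).toFinset :
      Set (Sym2 (Equiv.Perm (Fin 4)))) ⊆ F := by
    intro s hs
    simp only [Finset.mem_coe, List.mem_toFinset, List.mem_map] at hs
    obtain ⟨e, he, rfl⟩ := hs
    rw [hE, List.mem_filter] at he
    by_contra hn
    have := hT _ _ (SimpleGraph.deleteEdges_adj.2 ⟨bsEdges_adj e he.1, hn⟩)
    simp [this] at he
  have h3 := Set.ncard_le_ncard hsub (Set.toFinite F)
  rw [Set.ncard_coe_finset, List.toFinset_card_of_nodup hnd, List.length_map] at h3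
  omega

/-- A set of vertices that is closed under adjacency after deleting at most 11 edges has
at most 3 or at least 21 elements. -/
theorem bs_closed_card (F : Set (Sym2 (Equiv.Perm (Fin 4)))) (hcard : F.ncard ≤ 11)
    (T : Finset (Equiv.Perm (Fin 4)))
    (hT : ∀ x y, ((BS 4).deleteEdges F).Adj x y → (x ∈ T ↔ y ∈ T)) :
    T.card ≤ 3 ∨ 21 ≤ T.card := by
  by_cases h0 : bsVert 0 ∈ T
  · exact bs_closed_card_aux F hcard T h0 hT
  · have h1 := bs_closed_card_aux F hcard Tᶜ (Finset.mem_compl.2 h0) (fun x y h => by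
      rw [Finset.mem_compl, Finset.mem_compl, hT x y h])
    have h2 : Fintype.card (Equiv.Perm (Fin 4)) = 24 := by
      rw [Fintype.card_perm, Fintype.card_fin]; rfl
    have h3 := Finset.card_add_card_compl T
    omega

/-- If at most `11` edges are deleted from `BS_4` and the result is disconnected, then it
has a connected component with at least `4! - 3 = 21` vertices. -/
theorem BS4_big_component_eleven (F : Set (Sym2 (Equiv.Perm (Fin 4))))
    (hF : F ⊆ (BS 4).edgeSet) (hcard : F.ncard ≤ 11)
    (hdisc : ¬ ((BS 4).deleteEdges F).Connected) :
    ∃ C : ((BS 4).deleteEdges F).ConnectedComponent, 21 ≤ C.supp.ncard := by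
  classical
  by_contra hno
  push Not at hno
  set G := (BS 4).deleteEdges F with hG
  let P : Finset (Equiv.Perm (Fin 4)) → Prop := fun T =>
    (∀ x y, G.Adj x y → (x ∈ T ↔ y ∈ T)) ∧ T.card ≤ 20
  have hP0 : (Finset.univ.filter P).Nonempty := ⟨∅, by simp [P]⟩
  obtain ⟨T, hTm, hmax⟩ := Finset.exists_max_image (Finset.univ.filter P) Finset.card hP0
  have hT : P T := (Finset.mem_filter.1 hTm).2
  have hmax' : ∀ U, P U → U.card ≤ T.card := fun U hU =>
    hmax U (Finset.mem_filter.2 ⟨Finset.mem_univ _, hU⟩)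
  have hT3 : T.card ≤ 3 := by
    have := bs_closed_card F hcard T hT.1
    have := hT.2
    omega
  obtain ⟨x, hx⟩ : ∃ x, x ∉ T := by
    by_contra hall
    push Not at hall
    have h1 : T = Finset.univ := Finset.eq_univ_iff_forall.2 hall
    have h2 : (Finset.univ : Finset (Equiv.Perm (Fin 4))).card = 24 := by
      rw [Finset.card_univ, Fintype.card_perm, Fintype.card_fin]; rfl
    rw [h1] at hT3
    omega
  let C : Finset (Equiv.Perm (Fin 4)) := (G.connectedComponentMk x).supp.toFinset
  have hCmem : ∀ y, y ∈ C ↔ G.connectedComponentMk y = G.connectedComponentMk x := by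
    intro y
    simp [C]
  have hCcl : ∀ y z, G.Adj y z → (y ∈ C ↔ z ∈ C) := by
    intro y z h
    rw [hCmem, hCmem, SimpleGraph.ConnectedComponent.connectedComponentMk_eq_of_adj h]
  have hCcard : C.card ≤ 20 := by
    have := hno (G.connectedComponentMk x)
    rw [Set.ncard_eq_toFinset_card'] at this
    change C.card < 21 at this
    omega
  have hC3 := hmax' C ⟨hCcl, hCcard⟩
  have hU := hmax' (insert x (T ∪ C)) ⟨by
    have hxC : x ∈ C := (hCmem x).2 rfl
    have : insert x (T ∪ C) = T ∪ C :=
      Finset.insert_eq_self.2 (Finset.mem_union_right _ hxC)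
    rw [this]
    intro y z h
    rw [Finset.mem_union, Finset.mem_union, hT.1 y z h, hCcl y z h], by
    have h1 := Finset.card_insert_le x (T ∪ C)
    have h2 := Finset.card_union_le T C
    omega⟩
  have hlt : T.card < (insert x (T ∪ C)).card := by
    apply Finset.card_lt_card
    refine ⟨fun y hy => Finset.mem_insert_of_mem (Finset.mem_union_left _ hy), fun h => ?_⟩
    exact hx (h (Finset.mem_insert_self _ _))
  omega
end

section
/- Let n ≥ 3 and F_e ⊆ E(BS_n) with |F_e| ≤ 8n − 21. If BS_n − F_e is disconnected, then BS_n − F_e has a connected component H with |V(H)| ≥ n! − 3. -/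
open SimpleGraph

namespace BSAux
open Finset Equiv

/-- extend a permutation by fixing the last point -/
def ext {n : ℕ} (σ : Perm (Fin n)) : Perm (Fin (n+1)) where
  toFun := Fin.lastCases (Fin.last n) (fun i => (σ i).castSucc)
  invFun := Fin.lastCases (Fin.last n) (fun i => (σ.symm i).castSucc)
  left_inv := by
    intro x
    refine Fin.lastCases ?_ (fun i => ?_) x <;> simp
  right_inv := by
    intro x
    refine Fin.lastCases ?_ (fun i => ?_) x <;> simp

@[simp] lemma ext_last {n : ℕ} (σ : Perm (Fin n)) : ext σ (Fin.last n) = Fin.last n := by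
  simp [ext]

@[simp] lemma ext_castSucc {n : ℕ} (σ : Perm (Fin n)) (i : Fin n) :
    ext σ i.castSucc = (σ i).castSucc := by
  simp [ext]

lemma ext_mul {n : ℕ} (σ τ : Perm (Fin n)) : ext (σ * τ) = ext σ * ext τ := by
  ext x : 1
  refine Fin.lastCases ?_ (fun i => ?_) x <;> simp

lemma ext_swap {n : ℕ} (i j : Fin n) : ext (swap i j) = swap i.castSucc j.castSucc := by
  ext x : 1
  refine Fin.lastCases ?_ (fun k => ?_) x
  · rw [ext_last, swap_apply_of_ne_of_ne]
    · exact (Fin.castSucc_lt_last i).ne'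
    · exact (Fin.castSucc_lt_last j).ne'
  · rw [ext_castSucc]
    simp only [swap_apply_def, Fin.castSucc_inj]
    split_ifs <;> rfl

/-- the copy of `BS n` inside `BS (n+1)` with last value `c` -/
def emb {n : ℕ} (c : Fin (n+1)) (σ : Perm (Fin n)) : Perm (Fin (n+1)) :=
  swap c (Fin.last n) * ext σ

@[simp] lemma emb_last {n : ℕ} (c : Fin (n+1)) (σ : Perm (Fin n)) :
    emb c σ (Fin.last n) = c := by
  simp [emb]

lemma emb_mul_swap {n : ℕ} (c : Fin (n+1)) (σ : Perm (Fin n)) (i j : Fin n) :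
    emb c σ * swap i.castSucc j.castSucc = emb c (σ * swap i j) := by
  rw [emb, emb, ext_mul, ext_swap, mul_assoc]

lemma emb_bij (n : ℕ) :
    Function.Bijective (fun p : Fin (n+1) × Perm (Fin n) => emb p.1 p.2) := by
  rw [Fintype.bijective_iff_injective_and_card]
  constructor
  · rintro ⟨c, σ⟩ ⟨d, τ⟩ h
    simp only at h
    have hc : c = d := by
      have := congrArg (fun x => x (Fin.last n)) h
      simpa using this
    subst hc
    have h2 : ext σ = ext τ := mul_left_cancel h
    congr 1
    ext i : 1
    have := congrArg (fun x => x i.castSucc) h2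
    simpa using this
  · simp [Fintype.card_perm, Nat.factorial_succ]

lemma sum_emb {n : ℕ} (f : Perm (Fin (n+1)) → ℕ) :
    ∑ x, f x = ∑ c : Fin (n+1), ∑ σ : Perm (Fin n), f (emb c σ) := by
  rw [← (Equiv.ofBijective _ (emb_bij n)).sum_comp, Fintype.sum_prod_type]
  rfl

lemma card_emb {n : ℕ} (P : Perm (Fin (n+1)) → Prop) [DecidablePred P] :
    #{x | P x} = ∑ c : Fin (n+1), #{σ : Perm (Fin n) | P (emb c σ)} := by
  simp only [Finset.card_filter]
  exact sum_emb _

/-- slices -/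
def sl {n : ℕ} (S : Finset (Perm (Fin (n+1)))) (c : Fin (n+1)) : Finset (Perm (Fin n)) :=
  {σ | emb c σ ∈ S}

lemma card_slices {n : ℕ} (S : Finset (Perm (Fin (n+1)))) : #S = ∑ c, #(sl S c) := by
  have := card_emb (fun x => x ∈ S)
  simpa [sl] using this

lemma card_sl_filter {n : ℕ} (S : Finset (Perm (Fin (n+1)))) (A : Finset (Fin (n+1))) :
    #{x | x ∈ S ∧ x (Fin.last n) ∈ A} = ∑ c ∈ A, #(sl S c) := by
  rw [card_emb]
  simp only [emb_last]
  rw [← Finset.sum_subset (Finset.subset_univ A)]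
  · refine Finset.sum_congr rfl fun c hc => ?_
    simp [hc, sl]
  · intro c _ hc
    simp [hc]

lemma sl_compl {n : ℕ} (S : Finset (Perm (Fin (n+1)))) (c : Fin (n+1)) :
    sl Sᶜ c = (sl S c)ᶜ := by
  ext σ; simp [sl]

lemma card_sl_compl {n : ℕ} (S : Finset (Perm (Fin (n+1)))) (c : Fin (n+1)) :
    #(sl S c) + #(sl Sᶜ c) = n.factorial := by
  rw [sl_compl, Finset.card_add_card_compl, Fintype.card_perm, Fintype.card_fin]

/-- edges in direction `swap i j` leaving `S` -/
def cut {n : ℕ} (S : Finset (Perm (Fin n))) (i j : Fin n) : ℕ :=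
  #{x | x ∈ S ∧ x * swap i j ∉ S}

lemma cut_castSucc {n : ℕ} (S : Finset (Perm (Fin (n+1)))) (i j : Fin n) :
    cut S i.castSucc j.castSucc = ∑ c, cut (sl S c) i j := by
  unfold cut
  rw [card_emb]
  simp only [emb_mul_swap, sl, mem_filter, mem_univ, true_and]

lemma cut_compl {n : ℕ} (S : Finset (Perm (Fin n))) (i j : Fin n) :
    cut Sᶜ i j = cut S i j := by
  unfold cut
  apply Finset.card_bij' (fun x _ => x * swap i j) (fun x _ => x * swap i j) <;>
    simp +contextual [mul_assoc]

/-- generator positions -/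
def gen {n : ℕ} (i j : Fin n) : Prop := i < j ∧ (j.val = i.val + 1 ∨ i.val = 0)

instance {n : ℕ} (i j : Fin n) : Decidable (gen i j) := by unfold gen; infer_instance

/-- edge boundary size -/
def bd {n : ℕ} (S : Finset (Perm (Fin n))) : ℕ :=
  ∑ i, ∑ j, if gen i j then cut S i j else 0

lemma bd_compl {n : ℕ} (S : Finset (Perm (Fin n))) : bd Sᶜ = bd S := by
  simp only [bd, cut_compl]

lemma gen_castSucc {n : ℕ} (i j : Fin n) : gen i.castSucc j.castSucc ↔ gen i j := by
  simp [gen]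

lemma sum_gen_succ {n : ℕ} (f : Fin (n+3) → Fin (n+3) → ℕ) :
    (∑ i, ∑ j, if gen i j then f i j else 0) =
      (∑ i : Fin (n+2), ∑ j : Fin (n+2), if gen i j then f i.castSucc j.castSucc else 0)
      + (f (Fin.castSucc 0) (Fin.last _) + f (Fin.castSucc (Fin.last _)) (Fin.last _)) := by
  rw [Fin.sum_univ_castSucc]
  have h1 : ∀ j : Fin (n+3), ¬ gen (Fin.last (n+2)) j := by
    intro j h
    exact absurd h.1 (not_lt.mpr (Fin.le_last j))
  simp only [h1, if_false, Finset.sum_const_zero, add_zero]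
  have h2 : ∀ i : Fin (n+2), (∑ j, if gen i.castSucc j then f i.castSucc j else 0) =
     (∑ j : Fin (n+2), if gen i j then f i.castSucc j.castSucc else 0) +
       if gen i.castSucc (Fin.last (n+2)) then f i.castSucc (Fin.last _) else 0 := by
    intro i
    rw [Fin.sum_univ_castSucc]
    simp only [gen_castSucc]
  simp only [h2, Finset.sum_add_distrib]
  congr 1
  rw [Fin.sum_univ_castSucc, Fin.sum_univ_succ]
  have h3 : ∀ i : Fin n, ¬ gen (Fin.castSucc (Fin.castSucc i.succ)) (Fin.last (n+2)) := by
    rintro i ⟨_, h⟩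
    simp at h
    omega
  have h4 : gen (Fin.castSucc (Fin.castSucc (0 : Fin (n+1)))) (Fin.last (n+2)) := by
    constructor
    · exact Fin.castSucc_lt_last _
    · right; simp
  have h5 : gen (Fin.castSucc (Fin.last (n+1))) (Fin.last (n+2)) := by
    constructor
    · exact Fin.castSucc_lt_last _
    · left; simp
  rw [if_pos h5, if_pos h4, Finset.sum_eq_zero fun i _ => if_neg (h3 i)]
  simp

lemma bd_succ {n : ℕ} (S : Finset (Perm (Fin (n+3)))) :
    bd S = (∑ c, bd (sl S c)) + (cut S (Fin.castSucc 0) (Fin.last _) +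
      cut S (Fin.castSucc (Fin.last _)) (Fin.last _)) := by
  rw [bd, sum_gen_succ]
  congr 1
  simp only [bd, cut_castSucc]
  refine Eq.trans ?_ Finset.sum_comm
  refine Finset.sum_congr rfl fun i _ => ?_
  refine Eq.trans ?_ Finset.sum_comm
  refine Finset.sum_congr rfl fun j _ => ?_
  split_ifs <;> simp

lemma num_gen (n : ℕ) : (∑ i : Fin (n+2), ∑ j : Fin (n+2), if gen i j then 1 else 0) = 2*n+1 := by
  induction n with
  | zero => decide
  | succ n ih =>
    rw [sum_gen_succ (fun _ _ => 1), ih]; ring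

/-- Mantel-type bound -/
lemma mantel {n : ℕ} (S : Finset (Perm (Fin (n+2)))) :
    ∃ a b, a + b = #S ∧ (2*n+1) * #S ≤ bd S + 2*a*b := by
  refine ⟨#(S.filter (fun x => Perm.sign x = 1)), #(S.filter (fun x => ¬ Perm.sign x = 1)),
    Finset.card_filter_add_card_filter_not _, ?_⟩
  set A := S.filter (fun x => Perm.sign x = 1) with hA
  set B := S.filter (fun x => ¬ Perm.sign x = 1) with hB
  let inn : Fin (n+2) → Fin (n+2) → ℕ := fun i j => #{x | x ∈ S ∧ x * swap i j ∈ S}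
  have h1 : ∀ i j, #S = cut S i j + inn i j := by
    intro i j
    have := Finset.card_filter_add_card_filter_not (s := S) (fun x => x * swap i j ∉ S)
    rw [← this]
    simp only [cut, inn, not_not]
    congr 2 <;> (ext x; simp)
  have h2 : (2*n+1) * #S = bd S + ∑ i, ∑ j, if gen i j then inn i j else 0 := by
    rw [← num_gen, bd, Finset.sum_mul, ← Finset.sum_add_distrib]
    refine Finset.sum_congr rfl fun i _ => ?_
    rw [Finset.sum_mul, ← Finset.sum_add_distrib]
    refine Finset.sum_congr rfl fun j _ => ?_
    split_ifs
    · rw [one_mul]; exact h1 i j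
    · simp
  rw [h2]
  apply Nat.add_le_add_left
  let T : Finset ((Fin (n+2) × Fin (n+2)) × Perm (Fin (n+2))) :=
    {p | gen p.1.1 p.1.2 ∧ p.2 ∈ S ∧ p.2 * swap p.1.1 p.1.2 ∈ S}
  have h3 : (∑ i, ∑ j, if gen i j then inn i j else 0) = #T := by
    simp only [T, Finset.card_filter, Fintype.sum_prod_type, inn]
    refine Finset.sum_congr rfl fun i _ => ?_
    refine Finset.sum_congr rfl fun j _ => ?_
    rw [← Finset.card_filter]
    split_ifs with h <;> simp [h]
  rw [h3]
  have h4 : #T ≤ #((A ×ˢ B) ∪ (B ×ˢ A)) := by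
    apply Finset.card_le_card_of_injOn (fun p => (p.2, p.2 * swap p.1.1 p.1.2))
    · rintro ⟨⟨i, j⟩, x⟩ h
      simp only [T, coe_filter, mem_univ, true_and, Set.mem_ofPred_eq] at h
      obtain ⟨hg, hx, hy⟩ := h
      have hs : Perm.sign (x * swap i j) = - Perm.sign x := by
        rw [Perm.sign_mul, Perm.sign_swap hg.1.ne]; simp
      simp only [coe_union, coe_product, Set.mem_union, Set.mem_prod, mem_coe, hA, hB, mem_filter,
        hx, hy, true_and, hs]
      rcases Int.units_eq_one_or (Perm.sign x) with h | h <;> simp [h]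
    · rintro ⟨⟨i, j⟩, x⟩ h ⟨⟨k, l⟩, y⟩ h' he
      simp only [T, coe_filter, mem_univ, true_and, Set.mem_ofPred_eq] at h h'
      simp only [Prod.mk.injEq] at he
      obtain ⟨rfl, he⟩ := he
      have hsw := mul_left_cancel he
      have hij := h.1.1
      have hkl := h'.1.1
      have e1 : swap k l i = j := by rw [← hsw]; simp
      have e2 : i = k ∧ j = l := by
        rw [swap_apply_def] at e1
        split_ifs at e1 with a1 a2
        · exact ⟨a1, e1.symm⟩
        · subst a2 e1; exact absurd hij (not_lt.mpr hkl.le)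
        · exact absurd e1 hij.ne
      rw [e2.1, e2.2]
  refine h4.trans ((Finset.card_union_le _ _).trans ?_)
  rw [Finset.card_product, Finset.card_product]
  apply le_of_eq; ring

lemma card_last_eq {n : ℕ} (c : Fin (n+1)) :
    #{x : Perm (Fin (n+1)) | x (Fin.last n) = c} = n.factorial := by
  rw [card_emb]
  simp only [emb_last]
  rw [Finset.sum_eq_single c]
  · simp [Fintype.card_perm]
  · intro b _ hb; simp [hb]
  · simp

lemma card_pt_eq {n : ℕ} (p c : Fin (n+1)) :
    #{x : Perm (Fin (n+1)) | x p = c} = n.factorial := by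
  rw [← card_last_eq c]
  apply Finset.card_bij' (fun x _ => x * swap p (Fin.last n)) (fun x _ => x * swap p (Fin.last n)) <;>
    simp +contextual [mul_assoc]

lemma card_two {n : ℕ} (p : Fin (n+1)) (c d : Fin (n+2)) (h : c ≠ d) :
    #{x : Perm (Fin (n+2)) | x (Fin.last _) = c ∧ x p.castSucc = d} = n.factorial := by
  rw [card_emb]
  simp only [emb_last]
  rw [Finset.sum_eq_single c]
  · simp only [true_and]
    have hd : swap c (Fin.last _) d ≠ Fin.last (n+1) := by
      intro h'
      rw [Equiv.swap_apply_eq_iff] at h'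
      simp at h'
      exact h h'.symm
    obtain ⟨e, he⟩ := Fin.exists_castSucc_eq.mpr hd
    rw [← card_pt_eq p e]
    congr 1
    ext σ
    simp only [mem_filter, mem_univ, true_and, emb, Perm.mul_apply, ext_castSucc]
    rw [Equiv.swap_apply_eq_iff, ← he, Fin.castSucc_inj]
  · intro b _ hb; simp [hb]
  · simp

lemma cross_AB {n : ℕ} (S : Finset (Perm (Fin (n+2)))) (p : Fin (n+1))
    (A B : Finset (Fin (n+2))) (hAB : Disjoint A B) :
    #A * #B * n.factorial ≤ cut S p.castSucc (Fin.last _) + ∑ c ∈ A, #(sl Sᶜ c)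
      + ∑ c ∈ B, #(sl S c) := by
  have h1 : #{x : Perm (Fin (n+2)) | x (Fin.last _) ∈ A ∧ x p.castSucc ∈ B}
      = #A * #B * n.factorial := by
    rw [Finset.card_eq_sum_card_fiberwise (f := fun x => (x (Fin.last _), x p.castSucc))
      (t := A ×ˢ B)]
    · rw [← Finset.card_product, ← smul_eq_mul, ← Finset.sum_const]
      refine Finset.sum_congr rfl ?_
      rintro ⟨c, d⟩ hcd
      rw [mem_product] at hcd
      rw [← card_two p c d (fun h => Finset.disjoint_left.mp hAB hcd.1 (h ▸ hcd.2))]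
      congr 1
      ext x
      simp only [mem_filter, mem_univ, true_and, Prod.mk.injEq]
      constructor
      · rintro ⟨_, h⟩; exact h
      · rintro ⟨rfl, rfl⟩; exact ⟨hcd, rfl, rfl⟩
    · intro x hx
      simpa using hx
  rw [← h1, ← card_sl_filter, ← card_sl_filter]
  have h2 : #{x : Perm (Fin (n+2)) | x ∈ S ∧ x (Fin.last _) ∈ B} =
      #{x : Perm (Fin (n+2)) | x * swap p.castSucc (Fin.last _) ∈ S ∧ x p.castSucc ∈ B} := by
    apply Finset.card_bij' (fun x _ => x * swap p.castSucc (Fin.last _))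
      (fun x _ => x * swap p.castSucc (Fin.last _)) <;>
    simp +contextual [mul_assoc]
  rw [h2, cut]
  refine le_trans (Finset.card_le_card ?_)
    ((Finset.card_union_le _ _).trans (Nat.add_le_add_right (Finset.card_union_le _ _) _))
  intro x
  simp only [mem_filter, mem_univ, true_and, mem_union, mem_compl]
  tauto

lemma cross_one {n : ℕ} (S : Finset (Perm (Fin (n+2)))) (p : Fin (n+1)) (r : Fin (n+2)) :
    #(sl S r) ≤ cut S p.castSucc (Fin.last _) + ∑ c ∈ {r}ᶜ, #(sl S c) := by
  have h1 := card_sl_filter S {r}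
  rw [Finset.sum_singleton] at h1
  rw [← h1, ← card_sl_filter, cut]
  have h2 : #{x : Perm (Fin (n+2)) | x ∈ S ∧ x (Fin.last _) ∈ ({r}ᶜ : Finset _)} =
      #{x : Perm (Fin (n+2)) | x * swap p.castSucc (Fin.last _) ∈ S ∧
        x p.castSucc ∈ ({r}ᶜ : Finset _)} := by
    apply Finset.card_bij' (fun x _ => x * swap p.castSucc (Fin.last _))
      (fun x _ => x * swap p.castSucc (Fin.last _)) <;>
    simp +contextual [mul_assoc]
  rw [h2]
  refine le_trans (Finset.card_le_card ?_) (Finset.card_union_le _ _)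
  intro x
  simp only [mem_filter, mem_univ, true_and, mem_union, mem_compl, mem_singleton]
  rintro ⟨hx, hr⟩
  have : x p.castSucc ≠ r := by
    rw [← hr]
    intro h
    exact (Fin.castSucc_lt_last p).ne (x.injective h)
  tauto

lemma L1 {k : ℕ} (S : Finset (Perm (Fin (k+3)))) (A B : Finset (Fin (k+3)))
    (hAB : Disjoint A B) (hA : ∀ c ∈ A, 2 * #(sl Sᶜ c) ≤ bd (sl S c))
    (hB : ∀ c ∈ B, 2 * #(sl S c) ≤ bd (sl S c)) :
    2 * (#A * #B * (k+1).factorial) + ∑ c ∈ (A ∪ B)ᶜ, bd (sl S c) ≤ bd S := by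
  rw [bd_succ, ← Finset.sum_add_sum_compl (A ∪ B), Finset.sum_union hAB]
  have a1 := Finset.sum_le_sum hA
  have b1 := Finset.sum_le_sum hB
  rw [← Finset.mul_sum] at a1 b1
  have h1 : #A * #B * (k+1).factorial ≤ cut S (Fin.castSucc 0) (Fin.last _) +
      ∑ c ∈ A, #(sl Sᶜ c) + ∑ c ∈ B, #(sl S c) := cross_AB (n := k+1) S 0 A B hAB
  have h2 : #A * #B * (k+1).factorial ≤ cut S (Fin.castSucc (Fin.last _)) (Fin.last _) +
      ∑ c ∈ A, #(sl Sᶜ c) + ∑ c ∈ B, #(sl S c) := cross_AB (n := k+1) S (Fin.last _) A B hAB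
  omega

lemma L2 {k : ℕ} (S : Finset (Perm (Fin (k+3)))) (B : Finset (Fin (k+3)))
    (hB : ∀ c ∈ B, 2 * #(sl S c) ≤ bd (sl S c)) :
    2 * (∑ c ∈ B, #(sl S c)) + ∑ c ∈ Bᶜ, bd (sl S c) ≤ bd S := by
  rw [bd_succ, ← Finset.sum_add_sum_compl B]
  have b1 := Finset.sum_le_sum hB
  rw [← Finset.mul_sum] at b1
  omega

lemma L3 {k : ℕ} (S : Finset (Perm (Fin (k+3)))) (r : Fin (k+3))
    (hB : ∀ c ∈ ({r}ᶜ : Finset (Fin (k+3))), 2 * #(sl S c) ≤ bd (sl S c)) :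
    bd (sl S r) + 2 * #(sl S r) ≤ bd S := by
  rw [bd_succ, ← Finset.sum_add_sum_compl {r}, Finset.sum_singleton]
  have b1 := Finset.sum_le_sum hB
  rw [← Finset.mul_sum] at b1
  have h1 : #(sl S r) ≤ cut S (Fin.castSucc 0) (Fin.last _) + ∑ c ∈ {r}ᶜ, #(sl S c) :=
    cross_one (n := k+1) S 0 r
  have h2 : #(sl S r) ≤ cut S (Fin.castSucc (Fin.last _)) (Fin.last _) + ∑ c ∈ {r}ᶜ, #(sl S c) :=
    cross_one (n := k+1) S (Fin.last _) r
  omega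

lemma bd_sl_compl {k : ℕ} (S : Finset (Perm (Fin (k+3)))) (c : Fin (k+3)) :
    bd (sl Sᶜ c) = bd (sl S c) := by
  rw [sl_compl, bd_compl]

lemma small3 (T : Finset (Perm (Fin 3))) (h : #T ≤ 2) : 2 * #T ≤ bd T := by
  obtain ⟨a, b, hab, hm⟩ := mantel (n := 1) T
  have ha : a ≤ 2 := by omega
  have hb : b ≤ 2 := by omega
  interval_cases a <;> interval_cases b <;> omega

lemma mid3 (T : Finset (Perm (Fin 3))) (h : #T = 3) : 5 ≤ bd T := by
  obtain ⟨a, b, hab, hm⟩ := mantel (n := 1) T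
  have ha : a ≤ 3 := by omega
  have hb : b ≤ 3 := by omega
  interval_cases a <;> interval_cases b <;> omega

lemma small4 {k : ℕ} (hk : 2 ≤ k) (T : Finset (Perm (Fin (k+2)))) (h : #T ≤ 3) :
    2 * #T ≤ bd T := by
  obtain ⟨a, b, hab, hm⟩ := mantel T
  have h5 : 5 * #T ≤ (2*k+1) * #T := Nat.mul_le_mul_right _ (by omega)
  have ha : a ≤ 3 := by omega
  have hb : b ≤ 3 := by omega
  interval_cases a <;> interval_cases b <;> omega

lemma mantel_range {k : ℕ} (S : Finset (Perm (Fin (k+3)))) (h4 : 4 ≤ #S) (h : #S ≤ 4*k+2) :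
    8*k+4 ≤ bd S := by
  obtain ⟨a, b, hab, hm⟩ := mantel S
  rw [← hab] at h4 h hm
  zify at h4 h hm ⊢
  nlinarith [sq_nonneg ((a:ℤ)-b), mul_nonneg (sub_nonneg.mpr h4) (sub_nonneg.mpr h)]

lemma base_aux (S : Finset (Perm (Fin 4))) (h4 : 4 ≤ #S) (h3 : ∀ c, #(sl S c) ≤ 3) :
    12 ≤ bd S := by
  rcases Nat.lt_or_ge (#S) 7 with h | h
  · have := mantel_range (k := 1) S h4 (by omega)
    omega
  · let B : Finset (Fin 4) := {c | #(sl S c) ≤ 2}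
    have l2 : 2 * (∑ c ∈ B, #(sl S c)) + ∑ c ∈ Bᶜ, bd (sl S c) ≤ bd S := L2 (k := 1) S B (fun c hc => small3 _ (by simpa [B] using hc))
    have hR : ∀ c ∈ Bᶜ, #(sl S c) = 3 := by
      intro c hc
      have := h3 c
      simp [B] at hc
      omega
    have e1 : ∑ c ∈ Bᶜ, #(sl S c) = #Bᶜ * 3 := by
      rw [Finset.sum_congr rfl hR]; simp
    have e2 : #Bᶜ * 5 ≤ ∑ c ∈ Bᶜ, bd (sl S c) := by
      rw [← smul_eq_mul]
      exact Finset.card_nsmul_le_sum _ _ _ (fun c hc => mid3 _ (hR c hc))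
    have e3 := card_slices S
    rw [← Finset.sum_add_sum_compl B] at e3
    omega

lemma base (S : Finset (Perm (Fin 4))) (h4 : 4 ≤ #S) (h4' : 4 ≤ #Sᶜ) : 12 ≤ bd S := by
  have hc6 : ∀ c, #(sl S c) + #(sl Sᶜ c) = 6 := fun c => card_sl_compl S c
  by_cases hB : ∀ c, #(sl Sᶜ c) ≤ 3
  · rw [← bd_compl]
    exact base_aux _ h4' hB
  by_cases hA : ∀ c, #(sl S c) ≤ 3
  · exact base_aux _ h4 hA
  push Not at hA hB
  let A : Finset (Fin 4) := {c | #(sl Sᶜ c) ≤ 2}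
  let B : Finset (Fin 4) := {c | #(sl S c) ≤ 2}
  have hAB : Disjoint A B := by
    rw [Finset.disjoint_left]
    intro c h1 h2
    simp [A, B] at h1 h2
    have := hc6 c
    omega
  have l1 : 2 * (#A * #B * (1+1).factorial) + ∑ c ∈ (A ∪ B)ᶜ, bd (sl S c) ≤ bd S :=
    L1 (k := 1) S A B hAB
    (fun c hc => by
      rw [← bd_sl_compl]
      exact small3 _ (by simpa [A] using hc))
    (fun c hc => small3 _ (by simpa [B] using hc))
  have e2 : #(A ∪ B)ᶜ * 5 ≤ ∑ c ∈ (A ∪ B)ᶜ, bd (sl S c) := by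
    rw [← smul_eq_mul]
    refine Finset.card_nsmul_le_sum _ _ _ (fun c hc => mid3 _ ?_)
    simp [A, B] at hc
    have := hc6 c
    omega
  have e3 : #A + #B + #(A ∪ B)ᶜ = 4 := by
    rw [← Finset.card_union_of_disjoint hAB, Finset.card_add_card_compl]; simp
  have hA0 : 0 < #A := by
    obtain ⟨c, hc⟩ := hA
    refine Finset.card_pos.mpr ⟨c, ?_⟩
    have := hc6 c
    simp [A]; omega
  have hB0 : 0 < #B := by
    obtain ⟨c, hc⟩ := hB
    refine Finset.card_pos.mpr ⟨c, ?_⟩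
    have := hc6 c
    simp [B]; omega
  have hf : (1+1).factorial = 2 := rfl
  rw [hf] at l1
  generalize #A = a at *
  generalize #B = b at *
  have ha : a ≤ 3 := by omega
  have hb : b ≤ 3 := by omega
  interval_cases a <;> interval_cases b <;> omega

lemma step_aux {k : ℕ} (hk : 2 ≤ k)
    (ih : ∀ S : Finset (Perm (Fin (k+2))), 4 ≤ #S → 4 ≤ #Sᶜ → 8*k-4 ≤ bd S)
    (S : Finset (Perm (Fin (k+3)))) (h4 : 4 ≤ #S) (h3 : ∀ c, 4 ≤ #(sl Sᶜ c)) :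
    8*k+4 ≤ bd S := by
  rcases Nat.lt_or_ge (#S) (4*k+3) with h | h
  · exact mantel_range S h4 (by omega)
  let B : Finset (Fin (k+3)) := {c | #(sl S c) ≤ 3}
  have hB : ∀ c ∈ B, 2 * #(sl S c) ≤ bd (sl S c) :=
    fun c hc => small4 hk _ (by simpa [B] using hc)
  have l2 := L2 S B hB
  have hR' : ∀ c ∈ Bᶜ, 4 ≤ #(sl S c) := by
    intro c hc
    simp [B] at hc
    omega
  have hR : ∀ c ∈ Bᶜ, 8*k-4 ≤ bd (sl S c) := by
    intro c hc
    apply ih _ (hR' c hc)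
    rw [← sl_compl]; exact h3 c
  have e2 : #Bᶜ * (8*k-4) ≤ ∑ c ∈ Bᶜ, bd (sl S c) := by
    rw [← smul_eq_mul]
    exact Finset.card_nsmul_le_sum _ _ _ hR
  have e3 := card_slices S
  rw [← Finset.sum_add_sum_compl B] at e3
  rcases Nat.lt_or_ge (#Bᶜ) 2 with hr | hr
  · interval_cases hr' : #Bᶜ
    · rw [Finset.card_eq_zero] at hr'
      rw [hr', Finset.sum_empty] at e3
      omega
    · obtain ⟨r, hr2⟩ := Finset.card_eq_one.mp hr'
      have hBr : B = {r}ᶜ := by rw [← hr2, compl_compl]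
      have l3 := L3 S r (by rw [← hBr]; exact hB)
      have := hR r (by rw [hr2]; simp)
      have := hR' r (by rw [hr2]; simp)
      omega
  · have := Nat.mul_le_mul_right (8*k-4) hr
    omega

lemma step {k : ℕ} (hk : 2 ≤ k)
    (ih : ∀ S : Finset (Perm (Fin (k+2))), 4 ≤ #S → 4 ≤ #Sᶜ → 8*k-4 ≤ bd S)
    (S : Finset (Perm (Fin (k+3)))) (h4 : 4 ≤ #S) (h4' : 4 ≤ #Sᶜ) :
    8*k+4 ≤ bd S := by
  have hc6 : ∀ c, #(sl S c) + #(sl Sᶜ c) = (k+2).factorial := fun c => card_sl_compl S c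
  have hfac : 24 ≤ (k+2).factorial := Nat.factorial_le (show 4 ≤ k+2 by omega)
  by_cases hA : ∀ c, 4 ≤ #(sl Sᶜ c)
  · exact step_aux hk ih S h4 hA
  by_cases hB : ∀ c, 4 ≤ #(sl S c)
  · rw [← bd_compl]
    exact step_aux hk ih _ h4' (by rw [compl_compl]; exact hB)
  push Not at hA hB
  let A : Finset (Fin (k+3)) := {c | #(sl Sᶜ c) ≤ 3}
  let B : Finset (Fin (k+3)) := {c | #(sl S c) ≤ 3}
  have hAB : Disjoint A B := by
    rw [Finset.disjoint_left]
    intro c h1 h2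
    simp [A, B] at h1 h2
    have := hc6 c
    omega
  have l1 := L1 S A B hAB
    (fun c hc => by
      rw [← bd_sl_compl]
      exact small4 hk _ (by simpa [A] using hc))
    (fun c hc => small4 hk _ (by simpa [B] using hc))
  have e2 : #(A ∪ B)ᶜ * (8*k-4) ≤ ∑ c ∈ (A ∪ B)ᶜ, bd (sl S c) := by
    rw [← smul_eq_mul]
    refine Finset.card_nsmul_le_sum _ _ _ (fun c hc => ?_)
    simp [A, B] at hc
    apply ih
    · omega
    · rw [← sl_compl]; omega
  have e3 : #A + #B + #(A ∪ B)ᶜ = k+3 := by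
    rw [← Finset.card_union_of_disjoint hAB, Finset.card_add_card_compl]; simp
  have hA0 : 0 < #A := by
    obtain ⟨c, hc⟩ := hA
    refine Finset.card_pos.mpr ⟨c, ?_⟩
    simp [A]; omega
  have hB0 : 0 < #B := by
    obtain ⟨c, hc⟩ := hB
    refine Finset.card_pos.mpr ⟨c, ?_⟩
    simp [B]; omega
  have hf : 6 ≤ (k+1).factorial := Nat.factorial_le (show 3 ≤ k+1 by omega)
  have hab : #A + #B ≤ #A * #B + 1 := by nlinarith
  have hab2 := Nat.mul_le_mul_left (#A * #B) hf
  rcases Nat.lt_or_ge (#(A ∪ B)ᶜ) 2 with hr | hr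
  · interval_cases hr' : #(A ∪ B)ᶜ <;> omega
  · have := Nat.mul_le_mul_right (8*k-4) hr
    omega

lemma bd_main (k : ℕ) (hk : 2 ≤ k) :
    ∀ S : Finset (Perm (Fin (k+2))), 4 ≤ #S → 4 ≤ #Sᶜ → 8*k-4 ≤ bd S := by
  induction k, hk using Nat.le_induction with
  | base => exact base
  | succ k hk ih =>
    intro S h h'
    have := step hk ih S h h'
    omega

lemma bd_le_ncard {n : ℕ} (F : Set (Sym2 (Perm (Fin n)))) (S : Finset (Perm (Fin n)))
    (hS : ∀ x ∈ S, ∀ y, ((BS n).deleteEdges F).Adj x y → y ∈ S) : bd S ≤ F.ncard := by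
  classical
  let T : Finset ((Fin n × Fin n) × Perm (Fin n)) :=
    {p | gen p.1.1 p.1.2 ∧ p.2 ∈ S ∧ p.2 * swap p.1.1 p.1.2 ∉ S}
  have h3 : bd S = #T := by
    simp only [T, Finset.card_filter, Fintype.sum_prod_type, bd, cut]
    refine Finset.sum_congr rfl fun i _ => ?_
    refine Finset.sum_congr rfl fun j _ => ?_
    rw [← Finset.card_filter, ← Finset.card_filter]
    split_ifs with h <;> simp [h]
  rw [h3, ← Set.ncard_coe_finset]
  apply Set.ncard_le_ncard_of_injOn (fun p => s(p.2, p.2 * swap p.1.1 p.1.2)) _ _ (Set.toFinite F)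
  · rintro ⟨⟨i, j⟩, x⟩ h
    simp only [T, coe_filter, mem_univ, true_and, Set.mem_ofPred_eq] at h
    obtain ⟨hg, hx, hy⟩ := h
    by_contra hn
    apply hy
    apply hS x hx
    rw [SimpleGraph.deleteEdges_adj]
    refine ⟨?_, hn⟩
    rw [BS, SimpleGraph.fromRel_adj]
    refine ⟨fun h => hy (h ▸ hx), Or.inl ⟨i, j, hg.2, hg.1.ne, rfl⟩⟩
  · rintro ⟨⟨i, j⟩, x⟩ h ⟨⟨k, l⟩, y⟩ h' he
    simp only [T, coe_filter, mem_univ, true_and, Set.mem_ofPred_eq] at h h'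
    simp only [Sym2.eq_iff] at he
    rcases he with he | he
    swap
    · exact absurd h.2.1 (he.1 ▸ h'.2.2)
    obtain ⟨rfl, he⟩ := he
    have hsw := mul_left_cancel he
    have hij := h.1.1
    have hkl := h'.1.1
    have e1 : swap k l i = j := by rw [← hsw]; simp
    have e2 : i = k ∧ j = l := by
      rw [swap_apply_def] at e1
      split_ifs at e1 with a1 a2
      · exact ⟨a1, e1.symm⟩
      · subst a2 e1; exact absurd hij (not_lt.mpr hkl.le)
      · exact absurd e1 hij.ne
    rw [e2.1, e2.2]

/-- greedy union of components -/
lemma greedy {V : Type*} [Fintype V] [DecidableEq V] (G : SimpleGraph V) (t m : ℕ) (ht : 1 ≤ t)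
    (hV : t ≤ Fintype.card V) (hm : ∀ C : G.ConnectedComponent, C.supp.ncard ≤ m) :
    ∃ S : Finset V, (∀ x ∈ S, ∀ y, G.Adj x y → y ∈ S) ∧ t ≤ #S ∧ #S ≤ t - 1 + m := by
  classical
  let P : Finset (Finset V) := {S | (∀ x ∈ S, ∀ y, G.Adj x y → y ∈ S) ∧ t ≤ #S}
  have hP : P.Nonempty := ⟨univ, by simp [P, hV]⟩
  obtain ⟨S, hS, hmin⟩ := Finset.exists_min_image P (fun S => #S) hP
  simp only [P, mem_filter, mem_univ, true_and] at hS hmin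
  refine ⟨S, hS.1, hS.2, ?_⟩
  obtain ⟨x, hx⟩ : S.Nonempty := Finset.card_pos.mp (by omega)
  let C := G.connectedComponentMk x
  let K : Finset V := C.supp.toFinset
  have hK : #K ≤ m := by
    rw [← Set.ncard_eq_toFinset_card']; exact hm C
  have hxK : x ∈ K := by simp [K, C]
  by_contra hlt
  have h1 : #S - #K ≤ #(S \ K) := Finset.le_card_sdiff _ _
  have h2 : #S ≤ #(S \ K) := by
    apply hmin
    refine ⟨?_, by omega⟩
    intro u hu v huv
    rw [mem_sdiff] at hu ⊢
    refine ⟨hS.1 u hu.1 v huv, fun hv => hu.2 ?_⟩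
    simp only [K, Set.mem_toFinset, SimpleGraph.ConnectedComponent.mem_supp_iff] at hv ⊢
    rw [← hv]
    exact SimpleGraph.ConnectedComponent.sound huv.reachable
  have h3 : #(S \ K) < #S := by
    apply Finset.card_lt_card
    refine ⟨Finset.sdiff_subset, fun h => ?_⟩
    exact (mem_sdiff.mp (h hx)).2 hxK
  omega

end BSAux

/-- For `n ≥ 3`, if at most `8n - 21` edges are deleted from `BS_n` and the result is
disconnected, then it has a connected component with at least `n! - 3` vertices. -/
theorem BS_big_component_three (n : ℕ) (hn : 3 ≤ n)
    (F : Set (Sym2 (Equiv.Perm (Fin n)))) (hF : F ⊆ (BS n).edgeSet)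
    (hcard : F.ncard ≤ 8 * n - 21) (hdisc : ¬ ((BS n).deleteEdges F).Connected) :
    ∃ C : ((BS n).deleteEdges F).ConnectedComponent,
      n.factorial - 3 ≤ C.supp.ncard := by
  classical
  by_contra hno
  push Not at hno
  have hV : Fintype.card (Equiv.Perm (Fin n)) = n.factorial := by
    rw [Fintype.card_perm, Fintype.card_fin]
  rcases Nat.eq_or_lt_of_le hn with h3 | h4
  · subst h3
    have hf : Nat.factorial 3 = 6 := rfl
    rw [hf] at hno hV
    obtain ⟨S, hS, h1, h2⟩ := BSAux.greedy _ 2 2 (by norm_num) (by omega)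
      (fun C => Nat.le_of_lt_succ (hno C))
    have hb := BSAux.bd_le_ncard F S hS
    rcases Nat.lt_or_ge 2 S.card with h | h
    · have := BSAux.mid3 S (by omega)
      omega
    · have := BSAux.small3 S h
      omega
  · obtain ⟨k, rfl⟩ : ∃ k, n = k + 2 := ⟨n - 2, by omega⟩
    have hfac : 24 ≤ (k+2).factorial := Nat.factorial_le (show 4 ≤ k+2 by omega)
    obtain ⟨S, hS, h1, h2⟩ : ∃ S : Finset (Equiv.Perm (Fin (k+2))),
        (∀ x ∈ S, ∀ y, ((BS (k+2)).deleteEdges F).Adj x y → y ∈ S) ∧ 4 ≤ S.card ∧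
          S.card + 4 ≤ (k+2).factorial := by
      by_cases hC : ∃ C : ((BS (k+2)).deleteEdges F).ConnectedComponent, 4 ≤ C.supp.ncard
      · obtain ⟨C, hC⟩ := hC
        have hlt := hno C
        rw [Set.ncard_eq_toFinset_card'] at hC hlt
        refine ⟨C.supp.toFinset, ?_, hC, by omega⟩
        intro u hu v huv
        simp only [Set.mem_toFinset, SimpleGraph.ConnectedComponent.mem_supp_iff] at hu ⊢
        rw [← hu]
        exact SimpleGraph.ConnectedComponent.sound huv.symm.reachable
      · push Not at hC
        obtain ⟨S, hS, h1, h2⟩ := BSAux.greedy _ 4 3 (by norm_num) (by omega)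
          (fun C => Nat.le_of_lt_succ (hC C))
        exact ⟨S, hS, h1, by omega⟩
    have hb := BSAux.bd_le_ncard F S hS
    have hc : S.card + (Sᶜ).card = (k+2).factorial := by
      rw [Finset.card_add_card_compl, hV]
    have := BSAux.bd_main k (by omega) S h1 (by omega)
    omega
end

section
/- For n ≥ 4, the bubble-sort star graph BS_n is (6n−17)-conditional edge-fault-tolerant strongly Menger edge connected: for any edge set F_e with |F_e| ≤ 6n − 17 such that the minimum degree of BS_n − F_e is at least 2, and any two distinct vertices u, v, the graph BS_n − F_e contains min{d_{BS_n−F_e}(u), d_{BS_n−F_e}(v)} pairwise edge-disjoint paths joining u and v. -/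
open SimpleGraph

def FF (n k : ℕ) : ℕ :=
  if k = 0 then 0 else if k = 1 then 2 * n - 3 else if k = 2 then 4 * n - 8 else
    if k = 3 then (if n = 3 then 5 else 6 * n - 15) else 8 * n - 20

lemma FF_le (n k : ℕ) (hn : 4 ≤ n) : FF n k ≤ 8 * n - 20 := by
  unfold FF; split_ifs <;> omega

lemma FF_pos (n k : ℕ) (hn : 3 ≤ n) (hk : 0 < k) : 2 * n - 3 ≤ FF n k := by
  unfold FF; split_ifs <;> omega

lemma fact_big (n : ℕ) (hn : 5 ≤ n) (T : ℕ) (h : n * T = 2 * n.factorial) :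
    8 * n - 12 ≤ T := by
  obtain ⟨m, rfl⟩ : ∃ m, n = m + 1 := ⟨n - 1, by omega⟩
  rw [Nat.factorial_succ] at h
  have h2 : T = 2 * m.factorial := by
    have : (m + 1) * T = (m + 1) * (2 * m.factorial) := by rw [h]; ring
    exact Nat.eq_of_mul_eq_mul_left (by omega) this
  have h3 : 4 * (m + 1) ≤ m.factorial := by
    have h4 : 4 ≤ m := by omega
    clear h2 h hn
    induction m, h4 using Nat.le_induction with
    | base => decide
    | succ k hk ih =>
      rw [Nat.factorial_succ]
      nlinarith
  omega

lemma fact_lin (n : ℕ) (hn : 4 ≤ n) : 6 * n ≤ n.factorial := by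
  induction n, hn using Nat.le_induction with
  | base => decide
  | succ k hk ih =>
    rw [Nat.factorial_succ]
    nlinarith

lemma T_lin (n T : ℕ) (hn : 4 ≤ n) (h : n * T = 2 * n.factorial) : 2 * T ≤ n.factorial := by
  nlinarith

lemma FF_low (n k : ℕ) (hn : 4 ≤ n) : (1 ≤ k → 2 * n - 3 ≤ FF n k) ∧ (2 ≤ k → 4 * n - 8 ≤ FF n k) ∧
    (3 ≤ k → 6 * n - 15 ≤ FF n k) ∧ (4 ≤ k → 8 * n - 20 ≤ FF n k) := by
  unfold FF; split_ifs <;> omega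

lemma arith_pair3 (y z w i1 i2 I C : ℕ) (p1 : 0 < y) (p2 : 0 < z) (l1 : y < 6) (l2 : z < 6)
    (f1 : FF 3 (min y (6 - y)) ≤ i1) (f2 : FF 3 (min z (6 - z)) ≤ i2)
    (hI : i1 + i2 ≤ I) (hw1 : w ≤ y) (hw2 : w ≤ z)
    (hC : C + 2 * w = 2 * (y + z)) : FF 4 (y + z) ≤ I + C := by
  interval_cases y <;> interval_cases z <;> simp [FF] at f1 f2 ⊢ <;> omega

lemma arith_pair (n M y z w i1 i2 I C : ℕ) (hn : 4 ≤ n) (hM : 6 * n ≤ M)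
    (p1 : 0 < y) (p2 : 0 < z) (l1 : y < M) (l2 : z < M)
    (f1 : FF n (min y (M - y)) ≤ i1) (f2 : FF n (min z (M - z)) ≤ i2)
    (hI : i1 + i2 ≤ I) (hw1 : w ≤ y) (hw2 : w ≤ z)
    (hC : C + 2 * w = 2 * (y + z)) : FF (n + 1) (y + z) ≤ I + C := by
  obtain ⟨a1, a2, a3, a4⟩ := FF_low n (min y (M - y)) hn
  obtain ⟨b1, b2, b3, b4⟩ := FF_low n (min z (M - z)) hn
  have hg := FF_le (n + 1) (y + z) (by omega)
  have hg2 : y + z = 2 → FF (n + 1) (y + z) = 4 * n - 4 := by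
    intro h; rw [h]; simp [FF, show n ≠ 2 by omega]; omega
  have hg3 : y + z = 3 → FF (n + 1) (y + z) = 6 * n - 9 := by
    intro h; rw [h]; simp [FF, show n ≠ 2 by omega]; omega
  generalize FF (n + 1) (y + z) = g at *
  replace a1 := (a1 (by omega)).trans f1
  replace b1 := (b1 (by omega)).trans f2
  replace a2 := fun h => (a2 h).trans f1
  replace b2 := fun h => (b2 h).trans f2
  replace a3 := fun h => (a3 h).trans f1
  replace b3 := fun h => (b3 h).trans f2
  replace a4 := fun h => (a4 h).trans f1
  replace b4 := fun h => (b4 h).trans f2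
  clear f1 f2
  have hC1 : 2 * y ≤ C := by omega
  have hC2 : 2 * z ≤ C := by omega
  clear hC hw1 hw2
  by_cases h2 : y + z = 2
  · have := hg2 h2; omega
  by_cases h3 : y + z = 3
  · have := hg3 h3; omega
  clear hg2 hg3
  by_cases hy : M ≤ y + 3
  · omega
  by_cases hz : M ≤ z + 3
  · omega
  have m1 : min y (M - y) = y ∨ 4 ≤ min y (M - y) := by omega
  have m2 : min z (M - z) = z ∨ 4 ≤ min z (M - z) := by omega
  by_cases y4 : 4 ≤ min y (M - y)
  · have := a4 y4; omega
  by_cases z4 : 4 ≤ min z (M - z)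
  · have := b4 z4; omega
  rw [m1.resolve_right y4] at a2 a3 y4
  rw [m2.resolve_right z4] at b2 b3 z4
  clear a4 b4 m1 m2
  have : y ≤ 3 := by omega
  have : z ≤ 3 := by omega
  interval_cases y <;> interval_cases z <;> simp at a2 a3 b2 b3 <;> omega

lemma arith_triple3 (y z u w1 w2 w3 i1 i2 i3 I C : ℕ) (p1 : 0 < y) (p2 : 0 < z) (p3 : 0 < u)
    (l1 : y < 6) (l2 : z < 6) (l3 : u < 6)
    (f1 : FF 3 (min y (6 - y)) ≤ i1) (f2 : FF 3 (min z (6 - z)) ≤ i2)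
    (f3 : FF 3 (min u (6 - u)) ≤ i3)
    (hI : i1 + i2 + i3 ≤ I) (hw1 : w1 ≤ min y z) (hw2 : w2 ≤ min y u) (hw3 : w3 ≤ min z u)
    (t1 : w1 ≤ 4) (t2 : w2 ≤ 4) (t3 : w3 ≤ 4)
    (hC : C + 2 * (w1 + w2 + w3) = 2 * (y + z + u)) : FF 4 (y + z + u) ≤ I + C := by
  have d : ∀ k < 6, 0 < k → FF 3 (min k (6 - k)) =
      if k = 1 ∨ k = 5 then 3 else if k = 2 ∨ k = 4 then 4 else 5 := by decide
  rw [d y l1 p1] at f1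
  rw [d z l2 p2] at f2
  rw [d u l3 p3] at f3
  have hg := FF_le 4 (y + z + u) (by omega)
  have hg3 : y + z + u = 3 → FF 4 (y + z + u) = 9 := by
    intro h; rw [h]; rfl
  generalize FF 4 (y + z + u) = g at *
  have h1 : 3 ≤ i1 ∧ (2 ≤ y → y ≤ 4 → 4 ≤ i1) ∧ (y = 3 → 5 ≤ i1) := by split_ifs at f1 <;> omega
  have h2 : 3 ≤ i2 ∧ (2 ≤ z → z ≤ 4 → 4 ≤ i2) ∧ (z = 3 → 5 ≤ i2) := by split_ifs at f2 <;> omega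
  have h3 : 3 ≤ i3 ∧ (2 ≤ u → u ≤ 4 → 4 ≤ i3) ∧ (u = 3 → 5 ≤ i3) := by split_ifs at f3 <;> omega
  clear f1 f2 f3
  omega

lemma arith_triple (n M T y z u w1 w2 w3 i1 i2 i3 I C : ℕ) (hn : 4 ≤ n) (hM : 6 * n ≤ M)
    (hT : 2 * T ≤ M) (p1 : 0 < y) (p2 : 0 < z) (p3 : 0 < u)
    (l1 : y < M) (l2 : z < M) (l3 : u < M)
    (f1 : FF n (min y (M - y)) ≤ i1) (f2 : FF n (min z (M - z)) ≤ i2)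
    (f3 : FF n (min u (M - u)) ≤ i3)
    (hI : i1 + i2 + i3 ≤ I) (hw1 : w1 ≤ min y z) (hw2 : w2 ≤ min y u) (hw3 : w3 ≤ min z u)
    (t1 : w1 ≤ T) (t2 : w2 ≤ T) (t3 : w3 ≤ T)
    (hC : C + 2 * (w1 + w2 + w3) = 2 * (y + z + u)) : FF (n + 1) (y + z + u) ≤ I + C := by
  obtain ⟨a1, a2, -, -⟩ := FF_low n (min y (M - y)) hn
  obtain ⟨b1, b2, -, -⟩ := FF_low n (min z (M - z)) hn
  obtain ⟨c1, c2, -, -⟩ := FF_low n (min u (M - u)) hn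
  have hg := FF_le (n + 1) (y + z + u) (by omega)
  have hg3 : y + z + u = 3 → FF (n + 1) (y + z + u) = 6 * n - 9 := by
    intro h; rw [h]; simp [FF, show n ≠ 2 by omega]; omega
  generalize FF (n + 1) (y + z + u) = g at *
  replace a1 := (a1 (by omega)).trans f1
  replace b1 := (b1 (by omega)).trans f2
  replace c1 := (c1 (by omega)).trans f3
  replace a2 := fun h => (a2 h).trans f1
  replace b2 := fun h => (b2 h).trans f2
  replace c2 := fun h => (c2 h).trans f3
  clear f1 f2 f3
  by_cases h3 : y + z + u = 3
  · have := hg3 h3; omega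
  clear hg3
  by_cases ha : 2 ≤ min y (M - y) <;> by_cases hb : 2 ≤ min z (M - z) <;>
    by_cases hc : 2 ≤ min u (M - u) <;> simp only [ha, hb, hc, true_implies, false_implies] at a2 b2 c2 <;> omega

structure BlockData (n M T : ℕ) (x : Fin (n+1) → ℕ) (inner : Fin (n+1) → ℕ)
    (a e : Fin (n+1) → Fin (n+1) → ℕ) : Prop where
  hT : n * T = 2 * M
  hxM : ∀ i, x i ≤ M
  hin : ∀ i, FF n (min (x i) (M - x i)) ≤ inner i
  esymm : ∀ i j, e i j = e j i
  ea : ∀ i j, e i j ≤ a i j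
  ax : ∀ i j, a i j ≤ x i
  aT : ∀ i j, a i j ≤ T
  aM : ∀ i j, i ≠ j → T + x i ≤ M + a i j
  asum : ∀ i, ∑ j, a i j = 2 * x i
  aii : ∀ i, a i i = 0

namespace BlockData
variable {n M T : ℕ} {x inner : Fin (n+1) → ℕ} {a e : Fin (n+1) → Fin (n+1) → ℕ}

lemma four (h : BlockData n M T x inner a e) (hn : 3 ≤ n) 
    (hS : 4 ≤ (Finset.univ.filter (fun i => 0 < x i ∧ x i < M)).card) :
    8 * (n + 1) - 20 ≤ ∑ i, inner i := by
  have h1 : ∑ i ∈ Finset.univ.filter (fun i => 0 < x i ∧ x i < M), (2 * n - 3) ≤ ∑ i, inner i := by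
    refine (Finset.sum_le_sum (fun i hi => ?_)).trans
      (Finset.sum_le_sum_of_subset (Finset.filter_subset _ _))
    simp only [Finset.mem_filter] at hi
    exact (FF_pos n _ hn (by omega)).trans (h.hin i)
  rw [Finset.sum_const, smul_eq_mul] at h1
  have := Nat.mul_le_mul_right (2 * n - 3) hS
  omega

lemma mixed_inner (h : BlockData n M T x inner a e) (hn : 3 ≤ n) :
    (Finset.univ.filter (fun i => 0 < x i ∧ x i < M)).card * (2 * n - 3) ≤ ∑ i, inner i := by
  have h1 : ∑ i ∈ Finset.univ.filter (fun i => 0 < x i ∧ x i < M), (2 * n - 3) ≤ ∑ i, inner i := by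
    refine (Finset.sum_le_sum (fun i hi => ?_)).trans
      (Finset.sum_le_sum_of_subset (Finset.filter_subset _ _))
    simp only [Finset.mem_filter] at hi
    exact (FF_pos n _ hn (by omega)).trans (h.hin i)
  rwa [Finset.sum_const, smul_eq_mul] at h1

lemma fullempty (h : BlockData n M T x inner a e) (hn : 3 ≤ n) (hM : M = n.factorial)
    (p q : Fin (n+1)) (hp : x p = M) (hq : x q = 0) :
    8 * (n + 1) - 20 ≤ ∑ i, inner i + ∑ i, ∑ j, (a i j - e i j) := by
  have hMpos : 0 < M := hM ▸ Nat.factorial_pos n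
  have hin := h.mixed_inner hn
  set S := Finset.univ.filter (fun i => 0 < x i ∧ x i < M) with hS
  set A := Finset.univ.filter (fun i => x i = M) with hA
  set B := Finset.univ.filter (fun i => x i = 0) with hB
  have hpA : p ∈ A := by simp [hA, hp]
  have hqB : q ∈ B := by simp [hB, hq]
  have hAB : Disjoint A B := by
    rw [Finset.disjoint_left]; intro i; simp [hA, hB]; omega
  have hABS : Disjoint (A ∪ B) S := by
    rw [Finset.disjoint_left]; intro i; simp [hA, hB, hS]; omega
  have hcard : A.card + B.card + S.card = n + 1 := by
    rw [← Finset.card_union_of_disjoint hAB, ← Finset.card_union_of_disjoint hABS]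
    have : A ∪ B ∪ S = Finset.univ := by
      ext i; have := h.hxM i; simp [hA, hB, hS]; omega
    rw [this]; simp
  have hA1 : 1 ≤ A.card := Finset.card_pos.2 ⟨p, hpA⟩
  have hB1 : 1 ≤ B.card := Finset.card_pos.2 ⟨q, hqB⟩
  have cAB : ∀ i ∈ A, ∀ j ∈ B, T ≤ a i j - e i j := by
    intro i hi j hj
    simp only [hA, hB, Finset.mem_filter, Finset.mem_univ, true_and] at hi hj
    have hne : i ≠ j := by rintro rfl; omega
    have h1 := h.aM i j hne
    have h2 := h.esymm i j
    have h3 := h.ea j i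
    have h4 := h.ax j i
    omega
  have cpr : ∀ r ∈ S, T - x r ≤ a p r - e p r := by
    intro r hr
    simp only [hS, Finset.mem_filter, Finset.mem_univ, true_and] at hr
    have hne : p ≠ r := by rintro rfl; omega
    have h1 := h.aM p r hne
    have h2 := h.esymm p r
    have h3 := h.ea r p
    have h4 := h.ax r p
    omega
  have crq : ∀ r ∈ S, T + x r - M ≤ a r q - e r q := by
    intro r hr
    simp only [hS, Finset.mem_filter, Finset.mem_univ, true_and] at hr
    have hne : r ≠ q := by rintro rfl; omega
    have h1 := h.aM r q hne
    have h2 := h.esymm r q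
    have h3 := h.ea q r
    have h4 := h.ax q r
    omega
  have key : A.card * B.card * T + S.card * (2 * T - M) ≤ ∑ i, ∑ j, (a i j - e i j) := by
    rw [← Finset.sum_product' (f := fun i j => a i j - e i j)]
    have hpS : p ∉ S := by simp [hS, hp]
    have hqS : q ∉ S := by simp [hS, hq]
    have d1 : Disjoint (A ×ˢ B) (({p} : Finset (Fin (n+1))) ×ˢ S) := by
      rw [Finset.disjoint_left]; rintro ⟨i, j⟩ h1 h2
      simp [hA, hB, hS] at h1 h2; omega
    have d2 : Disjoint ((A ×ˢ B) ∪ (({p} : Finset (Fin (n+1))) ×ˢ S)) (S ×ˢ {q}) := by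
      rw [Finset.disjoint_left]; rintro ⟨i, j⟩ h1 h2
      simp [hA, hB, hS] at h1 h2
      obtain ⟨h2, rfl⟩ := h2
      rcases h1 with h1 | ⟨h1, _⟩
      · omega
      · omega
    refine le_trans ?_ (Finset.sum_le_sum_of_subset (Finset.subset_univ
      ((A ×ˢ B) ∪ (({p} : Finset (Fin (n+1))) ×ˢ S) ∪ (S ×ˢ {q}))))
    rw [Finset.sum_union d2, Finset.sum_union d1, add_assoc]
    refine add_le_add ?_ ?_
    · rw [← Finset.card_product, ← smul_eq_mul, ← Finset.sum_const]
      refine Finset.sum_le_sum ?_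
      rintro ⟨i, j⟩ hij
      rw [Finset.mem_product] at hij
      exact cAB i hij.1 j hij.2
    · rw [Finset.sum_product, Finset.sum_product, Finset.sum_singleton]
      simp only [Finset.sum_singleton]
      rw [← Finset.sum_add_distrib, ← smul_eq_mul, ← Finset.sum_const]
      refine Finset.sum_le_sum fun r hr => ?_
      have := cpr r hr
      have := crq r hr
      omega
  have hT := h.hT
  generalize ∑ i, ∑ j, (a i j - e i j) = C at *
  generalize ∑ i, inner i = I at *
  rcases Nat.lt_or_ge n 5 with h5 | h5
  · obtain rfl | rfl : n = 3 ∨ n = 4 := by omega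
    · simp [Nat.factorial] at hM
      have hT4 : T = 4 := by omega
      subst hM hT4
      generalize A.card = α at *
      generalize B.card = β at *
      generalize S.card = s at *
      have : α ≤ 3 := by omega
      have : β ≤ 3 := by omega
      interval_cases α <;> interval_cases β <;> omega
    · simp [Nat.factorial] at hM
      have hT4 : T = 12 := by omega
      subst hM hT4
      generalize A.card = α at *
      generalize B.card = β at *
      generalize S.card = s at *
      have : α ≤ 4 := by omega
      have : β ≤ 4 := by omega
      interval_cases α <;> interval_cases β <;> omega
  · have := fact_big n h5 T (by rw [hT, hM])
    have : 1 * T ≤ A.card * B.card * T := Nat.mul_le_mul_right T (Nat.mul_le_mul hA1 hB1)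
    omega

lemma nofull (h : BlockData n M T x inner a e) (hn : 3 ≤ n) (hM : M = n.factorial)
    (hx : ∀ i, x i < M) :
    FF (n + 1) (∑ i, x i) ≤ ∑ i, inner i + ∑ i, ∑ j, (a i j - e i j) := by
  by_cases hS : 4 ≤ (Finset.univ.filter (fun i => 0 < x i ∧ x i < M)).card
  · have := h.four hn hS
    have := FF_le (n+1) (∑ i, x i) (by omega)
    omega
  have hT := h.hT
  have hsum : ∑ i, ∑ j, (a i j - e i j) + ∑ i, ∑ j, e i j = 2 * ∑ i, x i := by
    rw [Finset.mul_sum, ← Finset.sum_add_distrib]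
    refine Finset.sum_congr rfl fun i _ => ?_
    rw [← h.asum i, ← Finset.sum_add_distrib]
    exact Finset.sum_congr rfl fun j _ => by have := h.ea i j; omega
  set S := Finset.univ.filter (fun i => 0 < x i ∧ x i < M) with hSdef
  have hSx : ∀ i ∉ S, x i = 0 := by
    intro i hi; have := hx i; simp [hSdef] at hi; omega
  have hSm : ∀ i ∈ S, 0 < x i := by
    intro i hi; simp [hSdef] at hi; omega
  have e0 : ∀ i ∉ S, ∀ j, e i j = 0 := by
    intro i hi j; have := hSx i hi; have := h.ea i j; have := h.ax i j; omega
  have eii : ∀ i, e i i = 0 := by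
    intro i; have := h.ea i i; have := h.aii i; omega
  have hxS : ∑ i, x i = ∑ i ∈ S, x i :=
    (Finset.sum_subset (Finset.subset_univ S) (fun i _ hi => hSx i hi)).symm
  have heS : ∑ i, ∑ j, e i j = ∑ i ∈ S, ∑ j ∈ S, e i j := by
    rw [← Finset.sum_subset (Finset.subset_univ S) (fun i _ hi => ?_)]
    · refine Finset.sum_congr rfl fun i _ => ?_
      exact (Finset.sum_subset (Finset.subset_univ S)
        (fun j _ hj => by rw [h.esymm]; exact e0 j hj i)).symm
    · exact Finset.sum_eq_zero fun j _ => e0 i hi j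
  have hiS : ∑ i ∈ S, inner i ≤ ∑ i, inner i := Finset.sum_le_sum_of_subset (Finset.subset_univ S)
  have hMn : (n = 3 ∧ M = 6 ∧ T = 4) ∨ (4 ≤ n ∧ 6 * n ≤ M ∧ 2 * T ≤ M) := by
    rcases Nat.lt_or_ge n 4 with h4 | h4
    · obtain rfl : n = 3 := by omega
      simp [Nat.factorial] at hM
      left; omega
    · right
      exact ⟨h4, hM ▸ fact_lin n h4, hM ▸ T_lin n T h4 (by rw [hT, hM])⟩
  rw [hxS] at hsum ⊢
  rw [heS] at hsum
  generalize ∑ i, ∑ j, (a i j - e i j) = C at *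
  generalize ∑ i, inner i = I at *
  clear hxS heS hM hT
  have hc : S.card = 0 ∨ S.card = 1 ∨ S.card = 2 ∨ S.card = 3 := by omega
  clear hS
  rcases hc with hc | hc | hc | hc
  · rw [Finset.card_eq_zero] at hc
    rw [hc]; simp [FF]
  · obtain ⟨i, hc⟩ := Finset.card_eq_one.1 hc
    have p1 := hSm i (by simp [hc])
    rw [hc] at hsum hiS ⊢
    simp only [Finset.sum_singleton, eii] at hsum hiS ⊢
    have f1 := h.hin i
    have l1 := hx i
    generalize x i = y at *
    rcases hMn with ⟨rfl, rfl, rfl⟩ | ⟨h4, h5, h6⟩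
    · interval_cases y <;> simp [FF] at f1 ⊢ <;> omega
    · unfold FF at f1 ⊢
      split_ifs at f1 ⊢ <;> omega
  · obtain ⟨i, j, hij, hc⟩ := Finset.card_eq_two.1 hc
    have p1 := hSm i (by simp [hc])
    have p2 := hSm j (by simp [hc])
    rw [hc] at hsum hiS ⊢
    simp only [Finset.sum_pair hij, eii] at hsum hiS ⊢
    have f1 := h.hin i
    have l1 := hx i
    have f2 := h.hin j
    have l2 := hx j
    have es := h.esymm i j
    have ea1 := (h.ea i j).trans (h.ax i j)
    have ea2 := (h.ea j i).trans (h.ax j i)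
    rw [← es] at ea2 hsum
    generalize x i = y at *
    generalize x j = z at *
    generalize e i j = w at *
    rcases hMn with ⟨rfl, rfl, rfl⟩ | ⟨h4, h5, h6⟩
    · exact arith_pair3 y z w _ _ I C p1 p2 l1 l2 f1 f2 hiS ea1 ea2 (by omega)
    · exact arith_pair n M y z w _ _ I C h4 h5 p1 p2 l1 l2 f1 f2 hiS ea1 ea2 (by omega)
  · obtain ⟨i, j, k, hij, hik, hjk, hc⟩ := Finset.card_eq_three.1 hc
    have p1 := hSm i (by simp [hc])
    have p2 := hSm j (by simp [hc])
    have p3 := hSm k (by simp [hc])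
    rw [hc] at hsum hiS ⊢
    have s3 : ∀ f : Fin (n+1) → ℕ, ∑ r ∈ ({i, j, k} : Finset (Fin (n+1))), f r = f i + f j + f k := by
      intro f
      rw [Finset.sum_insert (by simp [hij, hik]), Finset.sum_pair hjk, add_assoc]
    simp only [s3, eii] at hsum hiS ⊢
    have f1 := h.hin i
    have l1 := hx i
    have f2 := h.hin j
    have l2 := hx j
    have f3 := h.hin k
    have l3 := hx k
    have es1 := h.esymm i j
    have es2 := h.esymm i k
    have es3 := h.esymm j k
    have ea1 := (h.ea i j).trans (h.ax i j)
    have ea2 := (h.ea j i).trans (h.ax j i)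
    have ea3 := (h.ea i k).trans (h.ax i k)
    have ea4 := (h.ea k i).trans (h.ax k i)
    have ea5 := (h.ea j k).trans (h.ax j k)
    have ea6 := (h.ea k j).trans (h.ax k j)
    have t1 := (h.ea i j).trans (h.aT i j)
    have t2 := (h.ea i k).trans (h.aT i k)
    have t3 := (h.ea j k).trans (h.aT j k)
    rw [← es1] at ea2 hsum
    rw [← es2] at ea4 hsum
    rw [← es3] at ea6 hsum
    generalize x i = y at *
    generalize x j = z at *
    generalize x k = u at *
    generalize e i j = w1 at *
    generalize e i k = w2 at *
    generalize e j k = w3 at *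
    rcases hMn with ⟨rfl, rfl, rfl⟩ | ⟨h4, h5, h6⟩
    · exact arith_triple3 y z u w1 w2 w3 _ _ _ I C p1 p2 p3 l1 l2 l3 f1 f2 f3 hiS
        (le_min ea1 ea2) (le_min ea3 ea4) (le_min ea5 ea6) t1 t2 t3 (by omega)
    · exact arith_triple n M T y z u w1 w2 w3 _ _ _ I C h4 h5 h6 p1 p2 p3 l1 l2 l3 f1 f2 f3 hiS
        (le_min ea1 ea2) (le_min ea3 ea4) (le_min ea5 ea6) t1 t2 t3 (by omega)

end BlockData
section Gens

open Equiv

/-- The generating transpositions. -/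
def gens (n : ℕ) : Finset (Perm (Fin n)) :=
  Finset.univ.filter (fun s => ∃ i j : Fin n, (j.val = i.val + 1 ∨ i.val = 0) ∧ i ≠ j ∧ s = swap i j)

/-- Number of edges leaving `X`, in terms of generators. -/
def gcut (n : ℕ) (X : Finset (Perm (Fin n))) : ℕ :=
  ∑ s ∈ gens n, (X.filter (fun x => x * s ∉ X)).card

lemma gens3_card : (gens 3).card = 3 := by decide +kernel

lemma base3 : ∀ X : Finset (Perm (Fin 3)), FF 3 (min X.card (6 - X.card)) ≤ gcut 3 X := by
  decide +kernel

/-- Extend a permutation by fixing the last point. -/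
def pext {n : ℕ} (σ : Perm (Fin n)) : Perm (Fin (n + 1)) where
  toFun i := Fin.lastCases (Fin.last n) (fun j => (σ j).castSucc) i
  invFun i := Fin.lastCases (Fin.last n) (fun j => (σ.symm j).castSucc) i
  left_inv i := by refine Fin.lastCases ?_ (fun j => ?_) i <;> simp
  right_inv i := by refine Fin.lastCases ?_ (fun j => ?_) i <;> simp

@[simp] lemma pext_last {n : ℕ} (σ : Perm (Fin n)) : pext σ (Fin.last n) = Fin.last n := by
  simp [pext]

@[simp] lemma pext_castSucc {n : ℕ} (σ : Perm (Fin n)) (j : Fin n) :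
    pext σ j.castSucc = (σ j).castSucc := by
  simp [pext]

lemma pext_mul {n : ℕ} (σ τ : Perm (Fin n)) : pext (σ * τ) = pext σ * pext τ := by
  ext i
  refine Fin.lastCases ?_ (fun j => ?_) i <;> simp

lemma pext_inj {n : ℕ} : Function.Injective (pext (n := n)) := by
  intro σ τ h
  refine Equiv.ext fun j => ?_
  have := congrArg (fun f : Perm (Fin (n+1)) => f j.castSucc) h
  simpa using this

lemma pext_swap {n : ℕ} (i j : Fin n) : pext (swap i j) = swap i.castSucc j.castSucc := by
  refine Equiv.ext fun k => ?_
  refine Fin.lastCases ?_ (fun k => ?_) k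
  · rw [pext_last, swap_apply_of_ne_of_ne (Fin.castSucc_lt_last i).ne' (Fin.castSucc_lt_last j).ne']
  · rw [pext_castSucc]
    by_cases h1 : k = i
    · subst h1; simp
    by_cases h2 : k = j
    · subst h2; simp
    rw [swap_apply_of_ne_of_ne h1 h2, swap_apply_of_ne_of_ne] <;> simpa

lemma pext_surj {n : ℕ} (τ : Perm (Fin (n + 1))) (h : τ (Fin.last n) = Fin.last n) :
    ∃ σ, pext σ = τ := by
  have hne : ∀ j : Fin n, τ j.castSucc ≠ Fin.last n := by
    intro j hj
    rw [← h] at hj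
    exact (Fin.castSucc_lt_last j).ne (τ.injective hj)
  have hinj : Function.Injective (fun j : Fin n => (τ j.castSucc).castPred (hne j)) := by
    intro a b hab
    simpa using hab
  refine ⟨Equiv.ofBijective _ (Finite.injective_iff_bijective.1 hinj), Equiv.ext fun k => ?_⟩
  refine Fin.lastCases ?_ (fun k => ?_) k
  · rw [pext_last, h]
  · rw [pext_castSucc]; simp

/-- Parametrization of block `i`. -/
def phi {n : ℕ} (i : Fin (n + 1)) (σ : Perm (Fin n)) : Perm (Fin (n + 1)) :=
  swap i (Fin.last n) * pext σ

lemma phi_mul {n : ℕ} (i : Fin (n + 1)) (σ τ : Perm (Fin n)) : phi i (σ * τ) = phi i σ * pext τ := by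
  rw [phi, phi, pext_mul, mul_assoc]

lemma phi_card {n : ℕ} (i : Fin (n + 1)) (p : Perm (Fin (n + 1)) → Prop) [DecidablePred p] :
    (Finset.univ.filter (fun x : Perm (Fin (n + 1)) => x (Fin.last n) = i ∧ p x)).card =
    (Finset.univ.filter (fun σ : Perm (Fin n) => p (phi i σ))).card := by
  symm
  refine Finset.card_bij (fun σ _ => phi i σ) ?_ ?_ ?_
  · intro σ hσ
    simp only [Finset.mem_filter, Finset.mem_univ, true_and] at hσ ⊢
    exact ⟨by simp [phi], hσ⟩
  · intro σ _ τ _ h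
    exact pext_inj (mul_left_cancel h)
  · intro x hx
    simp only [Finset.mem_filter, Finset.mem_univ, true_and] at hx
    obtain ⟨σ, hσ⟩ := pext_surj (swap i (Fin.last n) * x) (by simp [hx.1])
    have : phi i σ = x := by rw [phi, hσ, ← mul_assoc, swap_mul_self, one_mul]
    exact ⟨σ, by simpa [this] using hx.2, this⟩

/-- The position before last. -/
def qpos (n : ℕ) (hn : 3 ≤ n) : Fin (n + 1) := ⟨n - 1, by omega⟩

lemma gens_succ (n : ℕ) (hn : 3 ≤ n) : gens (n + 1) =
    (gens n).image pext ∪ {swap 0 (Fin.last n), swap (qpos n hn) (Fin.last n)} := by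
  ext s
  simp only [gens, Finset.mem_union, Finset.mem_image, Finset.mem_filter, Finset.mem_univ, true_and,
    Finset.mem_insert, Finset.mem_singleton]
  constructor
  · rintro ⟨i, j, h, hij, rfl⟩
    have hi : i.val < n := by
      by_contra hi
      have := i.2; have := j.2
      omega
    by_cases hj : j.val = n
    · right
      have hj' : j = Fin.last n := Fin.ext hj
      subst hj'
      rcases h with h | h
      · right; congr 1; apply Fin.ext; simp [qpos]; simp at h; omega
      · left; congr 1; apply Fin.ext; simpa using h
    · left
      have hj2 : j.val < n := by have := j.2; omega
      refine ⟨swap ⟨i, hi⟩ ⟨j, hj2⟩, ⟨⟨i, hi⟩, ⟨j, hj2⟩, h, ?_, rfl⟩, ?_⟩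
      · intro hh; apply hij; apply Fin.ext; simpa using hh
      · rw [pext_swap]; rfl
  · rintro (⟨t, ⟨i, j, h, hij, rfl⟩, rfl⟩ | rfl | rfl)
    · exact ⟨i.castSucc, j.castSucc, by simpa using h, by simpa using hij, pext_swap i j⟩
    · refine ⟨0, Fin.last n, Or.inr rfl, ?_, rfl⟩
      intro h; have := congrArg Fin.val h; simp at this; omega
    · refine ⟨qpos n hn, Fin.last n, Or.inl ?_, ?_, rfl⟩
      · simp [qpos]; omega
      · intro h; have := congrArg Fin.val h; simp [qpos] at this; omega

lemma gens_card (n : ℕ) (hn : 3 ≤ n) : (gens n).card ≤ 2 * n - 3 := by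
  induction n, hn using Nat.le_induction with
  | base => rw [gens3_card]
  | succ n hn ih =>
    rw [gens_succ n hn]
    have h1 := Finset.card_union_le ((gens n).image pext) {swap 0 (Fin.last n), swap (qpos n hn) (Fin.last n)}
    have h2 := Finset.card_image_le (s := gens n) (f := pext)
    have h3 := Finset.card_le_two (a := swap 0 (Fin.last n)) (b := swap (qpos n hn) (Fin.last n))
    omega

lemma zero_ne_last (n : ℕ) (hn : 3 ≤ n) : (0 : Fin (n+1)) ≠ Fin.last n := by
  intro h; have := congrArg Fin.val h; simp at this; omega
lemma q_ne_last (n : ℕ) (hn : 3 ≤ n) : qpos n hn ≠ Fin.last n := by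
  intro h; have := congrArg Fin.val h; simp [qpos] at this; omega
lemma zero_ne_q (n : ℕ) (hn : 3 ≤ n) : (0 : Fin (n+1)) ≠ qpos n hn := by
  intro h; have := congrArg Fin.val h; simp [qpos] at this; omega

/-- Restriction of `X` to block `i`. -/
def blk {n : ℕ} (X : Finset (Perm (Fin (n + 1)))) (i : Fin (n + 1)) : Finset (Perm (Fin n)) :=
  Finset.univ.filter (fun σ => phi i σ ∈ X)

lemma blk_card {n : ℕ} (X : Finset (Perm (Fin (n + 1)))) (i : Fin (n + 1)) :
    (blk X i).card = (X.filter (fun x => x (Fin.last n) = i)).card := by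
  rw [blk, ← phi_card i (fun x => x ∈ X)]
  congr 1; ext x; simp [and_comm]

lemma gcut_succ (n : ℕ) (hn : 3 ≤ n) (X : Finset (Perm (Fin (n + 1)))) :
    gcut (n + 1) X = ∑ i, gcut n (blk X i) +
      ((X.filter (fun x => x * swap 0 (Fin.last n) ∉ X)).card +
       (X.filter (fun x => x * swap (qpos n hn) (Fin.last n) ∉ X)).card) := by
  have hne : swap 0 (Fin.last n) ≠ swap (qpos n hn) (Fin.last n) := by
    intro h
    have := congrArg (fun f : Perm (Fin (n+1)) => f (Fin.last n)) h
    simp only [swap_apply_right] at this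
    exact zero_ne_q n hn this
  have hd : Disjoint ((gens n).image pext) {swap 0 (Fin.last n), swap (qpos n hn) (Fin.last n)} := by
    rw [Finset.disjoint_left]
    intro s hs hs'
    obtain ⟨t, -, rfl⟩ := Finset.mem_image.1 hs
    have h0 := pext_last t
    rw [Finset.mem_insert, Finset.mem_singleton] at hs'
    rcases hs' with h | h <;> rw [h, swap_apply_right] at h0
    · exact zero_ne_last n hn h0
    · exact q_ne_last n hn h0
  rw [gcut, gens_succ n hn, Finset.sum_union hd, Finset.sum_pair hne,
    Finset.sum_image (fun a _ b _ h => pext_inj h)]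
  congr 1
  simp only [gcut]
  rw [Finset.sum_comm]
  refine Finset.sum_congr rfl fun s _ => ?_
  rw [Finset.card_eq_sum_card_fiberwise (f := fun x : Perm (Fin (n+1)) => x (Fin.last n)) (t := Finset.univ)
    (fun x _ => Finset.mem_coe.2 (Finset.mem_univ _))]
  refine Finset.sum_congr rfl fun i _ => ?_
  have := phi_card i (fun x => x ∈ X ∧ x * pext s ∉ X)
  convert this using 2
  · ext x; simp; tauto
  · ext σ; simp [blk, phi_mul]

lemma gcut_compl (n : ℕ) (X : Finset (Perm (Fin n))) : gcut n Xᶜ = gcut n X := by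
  refine Finset.sum_congr rfl fun s hs => ?_
  have hss : s * s = 1 := by
    simp only [gens, Finset.mem_filter] at hs
    obtain ⟨-, i, j, -, -, rfl⟩ := hs
    exact swap_mul_self i j
  refine Finset.card_bij (fun x _ => x * s) ?_ ?_ ?_
  · intro x hx
    simp at hx ⊢
    simp [mul_assoc, hss, hx]
  · intro x _ y _ h; exact mul_right_cancel h
  · intro x hx
    simp at hx
    refine ⟨x * s, ?_, ?_⟩
    · simp [mul_assoc, hss, hx]
    · simp [mul_assoc, hss]

end Gens
section Menger

open Classical in
/-- The number of edges of `G` leaving `X`. -/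
noncomputable def ecut {V : Type*} [Fintype V] [DecidableEq V] (G : SimpleGraph V) (X : Finset V) : ℕ :=
  ((X ×ˢ Xᶜ).filter (fun p => G.Adj p.1 p.2)).card

variable {V : Type*} [Fintype V] [DecidableEq V] {G : SimpleGraph V}

/-- Unit flow along a path. -/
lemma path_flow {u z : V} (p : G.Walk u z) (hp : p.IsPath) :
    ∃ g : V → V → ℤ, (∀ x y, g x y = - g y x) ∧ (∀ x y, s(x, y) ∉ p.edges → g x y = 0) ∧
      (∀ d ∈ p.darts, g d.fst d.snd = 1) ∧
      (∀ w, ∑ y, g w y = (if w = u then 1 else 0) - (if w = z then 1 else 0)) := by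
  induction p with
  | nil => exact ⟨fun _ _ => 0, by simp, by simp, by simp, by simp⟩
  | @cons u m z h p ih =>
    rw [Walk.cons_isPath_iff] at hp
    obtain ⟨g, g1, g2, g3, g4⟩ := ih hp.1
    have hum : u ≠ m := h.ne
    have hnot : s(u, m) ∉ p.edges := fun hh => hp.2 (p.fst_mem_support_of_mem_edges hh)
    refine ⟨fun x y => g x y + (if x = u ∧ y = m then 1 else 0) - (if x = m ∧ y = u then 1 else 0),
      ?_, ?_, ?_, ?_⟩
    · intro x y
      beta_reduce
      rw [g1 x y]
      simp only [and_comm]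
      ring
    · intro x y hxy
      rw [Walk.edges_cons, List.mem_cons, not_or] at hxy
      have e1 : ¬ (x = u ∧ y = m) := by rintro ⟨rfl, rfl⟩; exact hxy.1 rfl
      have e2 : ¬ (x = m ∧ y = u) := by rintro ⟨rfl, rfl⟩; exact hxy.1 Sym2.eq_swap
      simp [e1, e2, g2 x y hxy.2]
    · intro d hd
      rw [Walk.darts_cons, List.mem_cons] at hd
      rcases hd with rfl | hd
      · simp [g2 u m hnot, hum]
      · have hs1 : d.fst ∈ p.support := p.dart_fst_mem_support_of_mem_darts hd
        have hs2 : d.snd ∈ p.support := p.dart_snd_mem_support_of_mem_darts hd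
        have n1 : d.fst ≠ u := by rintro hh; exact hp.2 (hh ▸ hs1)
        have n2 : d.snd ≠ u := by rintro hh; exact hp.2 (hh ▸ hs2)
        simp [n1, n2, g3 d hd]
    · intro w
      rw [Finset.sum_sub_distrib, Finset.sum_add_distrib, g4 w]
      have e1 : ∑ y, (if w = u ∧ y = m then (1 : ℤ) else 0) = if w = u then 1 else 0 := by
        by_cases hw : w = u <;> simp [hw]
      have e2 : ∑ y, (if w = m ∧ y = u then (1 : ℤ) else 0) = if w = m then 1 else 0 := by
        by_cases hw : w = m <;> simp [hw]
      rw [e1, e2]; ring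

/-- Integral unit-capacity flow of value `k` from `u` to `v`. -/
structure IsFlow (G : SimpleGraph V) (u v : V) (k : ℕ) (f : V → V → ℤ) : Prop where
  anti : ∀ x y, f x y = - f y x
  le_one : ∀ x y, f x y ≤ 1
  nadj : ∀ x y, ¬ G.Adj x y → f x y = 0
  div : ∀ w, ∑ y, f w y = (if w = u then (k : ℤ) else 0) - (if w = v then (k : ℤ) else 0)

lemma IsFlow.net {u v : V} {k : ℕ} {f : V → V → ℤ} (hf : IsFlow G u v k f) (X : Finset V)
    (hu : u ∈ X) (hv : v ∉ X) : ∑ x ∈ X, ∑ y ∈ Xᶜ, f x y = k := by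
  have h1 : ∑ x ∈ X, ∑ y, f x y = k := by
    rw [Finset.sum_congr rfl (fun x _ => hf.div x), Finset.sum_sub_distrib]
    simp [hu, hv]
  have h2 : ∑ x ∈ X, ∑ y ∈ X, f x y = 0 := by
    have : ∑ x ∈ X, ∑ y ∈ X, f x y = - ∑ x ∈ X, ∑ y ∈ X, f x y := by
      conv_lhs => rw [Finset.sum_comm]
      rw [← Finset.sum_neg_distrib]
      refine Finset.sum_congr rfl fun x _ => ?_
      rw [← Finset.sum_neg_distrib]
      exact Finset.sum_congr rfl fun y _ => hf.anti y x
    linarith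
  rw [← h1, ← add_zero (∑ x ∈ X, ∑ y ∈ Xᶜ, f x y), ← h2, ← Finset.sum_add_distrib]
  refine Finset.sum_congr rfl fun x _ => ?_
  rw [add_comm, Finset.sum_add_sum_compl]

lemma reach_ext (R : V → V → Prop) {u x y : V} (h : ∃ p : G.Path u x, ∀ d ∈ p.1.darts, R d.fst d.snd)
    (hxy : G.Adj x y) (hR : R x y) : ∃ p : G.Path u y, ∀ d ∈ p.1.darts, R d.fst d.snd := by
  obtain ⟨p, hp⟩ := h
  refine ⟨(p.1.concat hxy).toPath, fun d hd => ?_⟩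
  have := (p.1.concat hxy).darts_bypass_subset_darts hd
  rw [Walk.darts_concat, List.concat_eq_append, List.mem_append] at this
  rcases this with h | h
  · exact hp d h
  · simp at h; subst h; exact hR

lemma flow_exists {u v : V} (huv : u ≠ v) (k : ℕ)
    (hcut : ∀ X : Finset V, u ∈ X → v ∉ X → k ≤ ecut G X) (j : ℕ) :
    j ≤ k → ∃ f, IsFlow G u v j f := by
  classical
  induction j with
  | zero =>
    intro _
    exact ⟨fun _ _ => 0, by simp, by simp, by simp, by simp⟩
  | succ j ih =>
    intro hj
    obtain ⟨f, hf⟩ := ih (by omega)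
    set X : Finset V := Finset.univ.filter
      (fun w => ∃ p : G.Path u w, ∀ d ∈ p.1.darts, f d.fst d.snd < 1) with hX
    have huX : u ∈ X := by
      simp only [hX, Finset.mem_filter, Finset.mem_univ, true_and]
      exact ⟨Path.nil, by simp⟩
    by_cases hvX : v ∈ X
    · simp only [hX, Finset.mem_filter, Finset.mem_univ, true_and] at hvX
      obtain ⟨p, hp⟩ := hvX
      obtain ⟨g, g1, g2, g3, g4⟩ := path_flow p.1 p.2
      have hg : ∀ x y, g x y = 0 ∨ (G.Adj x y ∧ g x y = 1 ∧ f x y < 1) ∨ (G.Adj x y ∧ g x y = -1) := by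
        intro x y
        by_cases hxy : s(x, y) ∈ p.1.edges
        · right
          have hadj : G.Adj x y := p.1.adj_of_mem_edges hxy
          rw [Walk.edges, List.mem_map] at hxy
          obtain ⟨d, hd, hde⟩ := hxy
          rw [dart_edge_eq_mk'_iff'] at hde
          have h1 := g3 d hd
          have h2 := hp d hd
          rcases hde with ⟨rfl, rfl⟩ | ⟨rfl, rfl⟩
          · exact Or.inl ⟨hadj, h1, h2⟩
          · right; refine ⟨hadj, ?_⟩; rw [g1, h1]
        · exact Or.inl (g2 x y hxy)
      refine ⟨fun x y => f x y + g x y, ?_, ?_, ?_, ?_⟩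
      · intro x y; beta_reduce; rw [hf.anti x y, g1 x y]; ring
      · intro x y; beta_reduce
        have := hf.le_one x y
        rcases hg x y with h | h | h <;> omega
      · intro x y hxy; beta_reduce
        rw [hf.nadj x y hxy]
        rcases hg x y with h | h | h
        · simp [h]
        · exact absurd h.1 hxy
        · exact absurd h.1 hxy
      · intro w
        rw [Finset.sum_add_distrib, hf.div w, g4 w]
        split_ifs <;> push_cast <;> ring
    · exfalso
      have hnet := hf.net X huX hvX
      have h1 : ∑ x ∈ X, ∑ y ∈ Xᶜ, f x y = ecut G X := by
        rw [← Finset.sum_product' (f := f), ecut, Finset.card_filter]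
        push_cast
        refine Finset.sum_congr rfl ?_
        rintro ⟨x, y⟩ hxy
        rw [Finset.mem_product, Finset.mem_compl] at hxy
        dsimp only at hxy ⊢
        split_ifs with hadj
        · by_contra hne
          have hlt : f x y < 1 := lt_of_le_of_ne (hf.le_one x y) hne
          apply hxy.2
          have hx := hxy.1
          simp only [hX, Finset.mem_filter, Finset.mem_univ, true_and] at hx ⊢
          exact reach_ext (fun a b => f a b < 1) hx hadj hlt
        · exact hf.nadj x y hadj
      have := hcut X huX hvX
      omega

lemma flow_paths {u v : V} (huv : u ≠ v) (k : ℕ) : ∀ f, IsFlow G u v k f →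
    ∃ P : Fin k → G.Path u v, (∀ i, ∀ d ∈ (P i).1.darts, f d.fst d.snd = 1) ∧
      ∀ i j : Fin k, i ≠ j →
        List.Disjoint ((P i : G.Walk u v).edges) ((P j : G.Walk u v).edges) := by
  classical
  induction k with
  | zero => intro f _; exact ⟨fun i => i.elim0, fun i => i.elim0, fun i => i.elim0⟩
  | succ k ih =>
    intro f hf
    set X : Finset V := Finset.univ.filter
      (fun w => ∃ p : G.Path u w, ∀ d ∈ p.1.darts, f d.fst d.snd = 1) with hX
    have huX : u ∈ X := by
      simp only [hX, Finset.mem_filter, Finset.mem_univ, true_and]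
      exact ⟨Path.nil, by simp⟩
    have hvX : v ∈ X := by
      by_contra hvX
      have hnet := hf.net X huX hvX
      have h1 : ∑ x ∈ X, ∑ y ∈ Xᶜ, f x y ≤ 0 := by
        refine Finset.sum_nonpos fun x hx => Finset.sum_nonpos fun y hy => ?_
        by_contra hlt
        have h1 : f x y = 1 := by have := hf.le_one x y; omega
        have hadj : G.Adj x y := by
          by_contra hna; have := hf.nadj x y hna; omega
        rw [Finset.mem_compl] at hy
        apply hy
        simp only [hX, Finset.mem_filter, Finset.mem_univ, true_and] at hx ⊢
        exact reach_ext (fun a b => f a b = 1) hx hadj h1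
      push_cast at hnet
      omega
    simp only [hX, Finset.mem_filter, Finset.mem_univ, true_and] at hvX
    obtain ⟨p, hp⟩ := hvX
    obtain ⟨g, g1, g2, g3, g4⟩ := path_flow p.1 p.2
    have hg : ∀ x y, s(x, y) ∈ p.1.edges → f x y = g x y := by
      intro x y hxy
      rw [Walk.edges, List.mem_map] at hxy
      obtain ⟨d, hd, hde⟩ := hxy
      rw [dart_edge_eq_mk'_iff'] at hde
      have h1 := g3 d hd
      have h2 := hp d hd
      rcases hde with ⟨rfl, rfl⟩ | ⟨rfl, rfl⟩
      · rw [h1, h2]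
      · rw [g1, hf.anti, h1, h2]
    have hf' : IsFlow G u v k (fun x y => f x y - g x y) := by
      refine ⟨?_, ?_, ?_, ?_⟩
      · intro x y; beta_reduce; rw [hf.anti x y, g1 x y]; ring
      · intro x y; beta_reduce
        by_cases hxy : s(x, y) ∈ p.1.edges
        · rw [hg x y hxy]; simp
        · rw [g2 x y hxy]; have := hf.le_one x y; omega
      · intro x y hxy; beta_reduce
        rw [hf.nadj x y hxy, g2 x y (fun h => hxy (p.1.adj_of_mem_edges h))]; simp
      · intro w
        rw [Finset.sum_sub_distrib, hf.div w, g4 w]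
        split_ifs <;> push_cast <;> ring
    obtain ⟨P, hP1, hP2⟩ := ih _ hf'
    have hoff : ∀ i, ∀ d ∈ (P i).1.darts, d.edge ∉ p.1.edges ∧ f d.fst d.snd = 1 := by
      intro i d hd
      have h1 := hP1 i d hd
      beta_reduce at h1
      have h2 : d.edge ∉ p.1.edges := by
        intro h
        have := hg d.fst d.snd h
        omega
      refine ⟨h2, ?_⟩
      have := g2 d.fst d.snd h2
      omega
    have hdis : ∀ i, List.Disjoint p.1.edges (P i).1.edges := by
      intro i e he he'
      rw [Walk.edges, List.mem_map] at he'
      obtain ⟨d, hd, rfl⟩ := he'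
      exact (hoff i d hd).1 he
    refine ⟨Fin.cons p P, ?_, ?_⟩
    · intro i
      refine Fin.cases ?_ (fun i => ?_) i
      · simpa using hp
      · intro d hd; rw [Fin.cons_succ] at hd; exact (hoff i d hd).2
    · intro i j
      refine Fin.cases ?_ (fun i => ?_) i <;> refine Fin.cases ?_ (fun j => ?_) j
      · intro h; exact absurd rfl h
      · intro _; simpa using hdis j
      · intro _; simpa using (hdis i).symm
      · intro h; simpa using hP2 i j (fun h' => h (by rw [h']))

theorem menger_edge {u v : V} (huv : u ≠ v) (k : ℕ)
    (hcut : ∀ X : Finset V, u ∈ X → v ∉ X → k ≤ ecut G X) : HasEdgeDisjointPaths G u v k := by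
  obtain ⟨f, hf⟩ := flow_exists huv k hcut k le_rfl
  obtain ⟨P, -, hP⟩ := flow_paths huv k f hf
  exact ⟨P, hP⟩

end Menger
section Cross

open Equiv

variable {n : ℕ}

/-- Vertices of `X` in block `i` with symbol `j` at position `p`. -/
def aset (X : Finset (Perm (Fin (n + 1)))) (p i j : Fin (n + 1)) : Finset (Perm (Fin (n + 1))) :=
  X.filter (fun x => x (Fin.last n) = i ∧ x p = j)

/-- Those whose partner is also in `X`. -/
def eset (X : Finset (Perm (Fin (n + 1)))) (p i j : Fin (n + 1)) : Finset (Perm (Fin (n + 1))) :=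
  (aset X p i j).filter (fun x => x * swap p (Fin.last n) ∈ X)

lemma cross_eq (X : Finset (Perm (Fin (n + 1)))) (p : Fin (n + 1)) :
    (X.filter (fun x => x * swap p (Fin.last n) ∉ X)).card =
      ∑ i, ∑ j, ((aset X p i j).card - (eset X p i j).card) := by
  rw [Finset.card_eq_sum_card_fiberwise (f := fun x : Perm (Fin (n+1)) => x (Fin.last n))
    (t := Finset.univ) (fun x _ => Finset.mem_coe.2 (Finset.mem_univ _))]
  refine Finset.sum_congr rfl fun i _ => ?_
  rw [Finset.card_eq_sum_card_fiberwise (f := fun x : Perm (Fin (n+1)) => x p)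
    (t := Finset.univ) (fun x _ => Finset.mem_coe.2 (Finset.mem_univ _))]
  refine Finset.sum_congr rfl fun j _ => ?_
  have := Finset.card_filter_add_card_filter_not (s := aset X p i j)
    (fun x => x * swap p (Fin.last n) ∈ X)
  rw [← this, eset, Nat.add_sub_cancel_left]
  congr 1
  ext x; simp [aset]; tauto

lemma eset_symm (X : Finset (Perm (Fin (n + 1)))) (p i j : Fin (n + 1)) :
    (eset X p i j).card = (eset X p j i).card := by
  refine Finset.card_bij (fun x _ => x * swap p (Fin.last n)) ?_ ?_ ?_
  · intro x hx
    simp [eset, aset] at hx ⊢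
    simp [mul_assoc, hx]
  · intro x _ y _ h; exact mul_right_cancel h
  · intro x hx
    simp [eset, aset] at hx
    refine ⟨x * swap p (Fin.last n), ?_, ?_⟩
    · simp [eset, aset, mul_assoc, hx]
    · simp [mul_assoc]

lemma eset_le (X : Finset (Perm (Fin (n + 1)))) (p i j : Fin (n + 1)) :
    (eset X p i j).card ≤ (aset X p i j).card := Finset.card_le_card (Finset.filter_subset _ _)

lemma aset_sum (X : Finset (Perm (Fin (n + 1)))) (p i : Fin (n + 1)) :
    ∑ j, (aset X p i j).card = (blk X i).card := by
  rw [blk_card, Finset.card_eq_sum_card_fiberwise (s := X.filter _) 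
    (f := fun x : Perm (Fin (n+1)) => x p)
    (t := Finset.univ) (fun x _ => Finset.mem_coe.2 (Finset.mem_univ _))]
  refine Finset.sum_congr rfl fun j _ => ?_
  congr 1
  ext x; simp [aset]; tauto

lemma aset_two (X : Finset (Perm (Fin (n + 1)))) (p q i j : Fin (n + 1)) (hpq : p ≠ q) :
    (aset X p i j).card + (aset X q i j).card ≤ (blk X i).card := by
  rw [blk_card, ← Finset.card_union_of_disjoint]
  · refine Finset.card_le_card ?_
    intro x; simp [aset]; tauto
  · rw [Finset.disjoint_left]
    intro x; simp [aset]
    intro _ _ h1 _ _ h2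
    exact hpq (x.injective (h1.trans h2.symm))

lemma aset_self (X : Finset (Perm (Fin (n + 1)))) (p i : Fin (n + 1)) (hp : p ≠ Fin.last n) :
    (aset X p i i).card = 0 := by
  rw [Finset.card_eq_zero]
  ext x; simp [aset]
  intro _ h1 h2
  exact hp (x.injective (h2.trans h1.symm))

lemma aset_add_compl (X : Finset (Perm (Fin (n + 1)))) (p i j : Fin (n + 1)) :
    (aset X p i j).card + (aset Xᶜ p i j).card = (aset Finset.univ p i j).card := by
  rw [← Finset.card_union_of_disjoint]
  · congr 1; ext x; simp [aset]; tauto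
  · rw [Finset.disjoint_left]
    intro x; simp [aset]; tauto

lemma aset_univ_eq (p i j k : Fin (n + 1)) (hj : i ≠ j) (hk : i ≠ k) :
    (aset Finset.univ p i j).card = (aset Finset.univ p i k).card := by
  have hi : swap j k i = i := swap_apply_of_ne_of_ne hj hk
  refine Finset.card_bij (fun x _ => swap j k * x) ?_ ?_ ?_
  · intro x hx
    simp [aset] at hx ⊢
    simp [hx, hi]
  · intro x _ y _ h; exact mul_left_cancel h
  · intro x hx
    simp [aset] at hx
    refine ⟨swap j k * x, ?_, ?_⟩
    · simp [aset, hx, hi]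
    · simp [← mul_assoc]

lemma aset_univ_card (p i j : Fin (n + 1)) (hp : p ≠ Fin.last n) (hj : i ≠ j) :
    n * (aset Finset.univ p i j).card = n.factorial := by
  have h := aset_sum Finset.univ p i
  have hb : (blk (Finset.univ : Finset (Perm (Fin (n+1)))) i).card = n.factorial := by
    simp [blk, Fintype.card_perm]
  rw [hb, ← Finset.add_sum_erase _ _ (Finset.mem_univ i), aset_self _ _ _ hp, zero_add,
    Finset.sum_congr rfl (fun k hk => (aset_univ_eq p i j k hj (Finset.ne_of_mem_erase hk).symm).symm),
    Finset.sum_const, smul_eq_mul, Finset.card_erase_of_mem (Finset.mem_univ i)] at h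
  simpa using h

lemma blk_le (X : Finset (Perm (Fin (n + 1)))) (i : Fin (n + 1)) : (blk X i).card ≤ n.factorial := by
  have := Finset.card_le_univ (blk X i)
  rwa [Fintype.card_perm, Fintype.card_fin] at this

lemma blk_compl (X : Finset (Perm (Fin (n + 1)))) (i : Fin (n + 1)) :
    (blk Xᶜ i).card + (blk X i).card = n.factorial := by
  have : blk Xᶜ i = (blk X i)ᶜ := by ext; simp [blk]
  rw [this, Finset.card_compl_add_card, Fintype.card_perm, Fintype.card_fin]

lemma blk_sum (X : Finset (Perm (Fin (n + 1)))) : ∑ i, (blk X i).card = X.card := by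
  rw [Finset.card_eq_sum_card_fiberwise (s := X) 
    (f := fun x : Perm (Fin (n+1)) => x (Fin.last n))
    (t := Finset.univ) (fun x _ => Finset.mem_coe.2 (Finset.mem_univ _))]
  exact Finset.sum_congr rfl fun i _ => blk_card X i

lemma blockData (hn : 3 ≤ n) (X : Finset (Perm (Fin (n + 1))))
    (ih : ∀ Y : Finset (Perm (Fin n)), FF n (min Y.card (n.factorial - Y.card)) ≤ gcut n Y) :
    ∃ T, ∃ a e : Fin (n + 1) → Fin (n + 1) → ℕ,
      BlockData n n.factorial T (fun i => (blk X i).card) (fun i => gcut n (blk X i)) a e ∧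
      gcut (n + 1) X = ∑ i, gcut n (blk X i) + ∑ i, ∑ j, (a i j - e i j) := by
  have h0 := zero_ne_last n hn
  have hq := q_ne_last n hn
  set q := qpos n hn with hqd
  obtain ⟨T, hT⟩ : ∃ T, n * T = n.factorial :=
    ⟨_, aset_univ_card (0 : Fin (n+1)) (Fin.last n) 0 h0 h0.symm⟩
  have hU : ∀ p i j : Fin (n+1), p ≠ Fin.last n → i ≠ j → (aset Finset.univ p i j).card = T := by
    intro p i j hp hij
    have := aset_univ_card p i j hp hij
    rw [← hT] at this
    exact Nat.eq_of_mul_eq_mul_left (by omega) this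
  refine ⟨2 * T, fun i j => (aset X 0 i j).card + (aset X q i j).card,
    fun i j => (eset X 0 i j).card + (eset X q i j).card, ?_, ?_⟩
  · refine ⟨?_, ?_, ?_, ?_, ?_, ?_, ?_, ?_, ?_, ?_⟩
    · rw [← hT]; ring
    · exact fun i => blk_le X i
    · exact fun i => ih _
    · intro i j; rw [eset_symm X 0 i j, eset_symm X q i j]
    · intro i j; exact add_le_add (eset_le _ _ _ _) (eset_le _ _ _ _)
    · intro i j; exact aset_two _ _ _ _ _ (zero_ne_q n hn)
    · intro i j
      by_cases hij : i = j
      · subst hij; rw [aset_self _ _ _ h0, aset_self _ _ _ hq]; omega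
      · have h1 := aset_add_compl X 0 i j
        have h2 := aset_add_compl X q i j
        rw [hU _ _ _ h0 hij] at h1
        rw [hU _ _ _ hq hij] at h2
        omega
    · intro i j hij
      have h1 := aset_add_compl X 0 i j
      have h2 := aset_add_compl X q i j
      rw [hU _ _ _ h0 hij] at h1
      rw [hU _ _ _ hq hij] at h2
      have h3 := aset_two Xᶜ 0 q i j (zero_ne_q n hn)
      have h4 := blk_compl X i
      omega
    · intro i
      rw [Finset.sum_add_distrib, aset_sum, aset_sum]; ring
    · intro i
      rw [aset_self _ _ _ h0, aset_self _ _ _ hq]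
  · rw [gcut_succ n hn X, cross_eq, cross_eq, ← Finset.sum_add_distrib]
    congr 1
    refine Finset.sum_congr rfl fun i _ => ?_
    rw [← Finset.sum_add_distrib]
    refine Finset.sum_congr rfl fun j _ => ?_
    have h1 := eset_le X 0 i j
    have h2 := eset_le X q i j
    rw [← hqd]
    beta_reduce
    omega

lemma FF_mono (n k l : ℕ) (hn : 4 ≤ n) (h : k ≤ l) : FF n k ≤ FF n l := by
  unfold FF; split_ifs <;> omega

theorem gcut_lower (n : ℕ) (hn : 3 ≤ n) : ∀ X : Finset (Perm (Fin n)),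
    FF n (min X.card (n.factorial - X.card)) ≤ gcut n X := by
  induction n, hn using Nat.le_induction with
  | base => exact base3
  | succ n hn ih =>
    intro X
    have key : ∀ Y : Finset (Perm (Fin (n + 1))), (∀ i, (blk Y i).card < n.factorial) →
        FF (n + 1) Y.card ≤ gcut (n + 1) Y := by
      intro Y hY
      obtain ⟨T, a, e, h1, h2⟩ := blockData hn Y ih
      have := h1.nofull hn rfl hY
      rw [blk_sum] at this
      rwa [h2]
    by_cases hfull : ∀ i, (blk X i).card < n.factorial
    · exact (FF_mono _ _ _ (by omega) (min_le_left _ _)).trans (key X hfull)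
    by_cases hempty : ∀ i, 0 < (blk X i).card
    · have h1 := key Xᶜ (fun i => by have := blk_compl X i; have := hempty i; omega)
      rw [gcut_compl, Finset.card_compl, Fintype.card_perm, Fintype.card_fin] at h1
      exact (FF_mono _ _ _ (by omega) (min_le_right _ _)).trans h1
    push Not at hfull hempty
    obtain ⟨p, hp⟩ := hfull
    obtain ⟨q, hq⟩ := hempty
    obtain ⟨T, a, e, h1, h2⟩ := blockData hn X ih
    have h3 := h1.fullempty hn rfl p q (le_antisymm (blk_le X p) hp) (by simpa using hq)
    rw [h2]
    exact (FF_le _ _ (by omega)).trans h3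

end Cross

section Final

open Equiv

lemma BS_adj_iff (n : ℕ) (x y : Perm (Fin n)) : (BS n).Adj x y ↔ ∃ s ∈ gens n, y = x * s := by
  simp only [BS, SimpleGraph.fromRel_adj, BSRel, gens, Finset.mem_filter, Finset.mem_univ, true_and]
  constructor
  · rintro ⟨-, ⟨i, j, h, hij, rfl⟩ | ⟨i, j, h, hij, rfl⟩⟩
    · exact ⟨_, ⟨i, j, h, hij, rfl⟩, rfl⟩
    · exact ⟨_, ⟨i, j, h, hij, rfl⟩, by simp [mul_assoc]⟩
  · rintro ⟨s, ⟨i, j, h, hij, rfl⟩, rfl⟩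
    refine ⟨?_, Or.inl ⟨i, j, h, hij, rfl⟩⟩
    intro hh
    have := swap_eq_one_iff.1 (mul_eq_left.1 hh.symm)
    exact hij this

lemma BS_adj_sign (n : ℕ) (x y : Perm (Fin n)) (h : (BS n).Adj x y) : Perm.sign y = - Perm.sign x := by
  rw [BS_adj_iff] at h
  obtain ⟨s, hs, rfl⟩ := h
  simp only [gens, Finset.mem_filter] at hs
  obtain ⟨-, i, j, -, hij, rfl⟩ := hs
  rw [Perm.sign_mul, Perm.sign_swap hij]; simp

lemma gcut_le_ecut (n : ℕ) (X : Finset (Perm (Fin n))) : gcut n X ≤ ecut (BS n) X := by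
  classical
  rw [gcut, ← Finset.card_sigma]
  refine Finset.card_le_card_of_injOn (fun z => (z.2, z.2 * z.1)) ?_ ?_
  · rintro ⟨s, x⟩ h
    simp only [Finset.coe_sigma, Set.mem_sigma_iff, Finset.mem_coe, Finset.mem_filter] at h
    simp only [Finset.coe_filter, Finset.mem_product, Finset.mem_compl, Set.mem_setOf_eq]
    exact ⟨⟨h.2.1, h.2.2⟩, (BS_adj_iff n _ _).2 ⟨s, h.1, rfl⟩⟩
  · rintro ⟨s, x⟩ _ ⟨t, y⟩ _ h
    simp only [Prod.mk.injEq] at h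
    obtain ⟨rfl, h⟩ := h
    rw [mul_left_cancel h]

lemma ecut_delete {V : Type*} [Fintype V] [DecidableEq V] (G : SimpleGraph V) (F : Set (Sym2 V))
    (X : Finset V) : ecut G X ≤ ecut (G.deleteEdges F) X + F.ncard := by
  classical
  have hF : F.Finite := Set.toFinite F
  rw [Set.ncard_eq_toFinset_card F hF]
  set A := (X ×ˢ Xᶜ).filter (fun p => G.Adj p.1 p.2 ∧ s(p.1, p.2) ∈ F) with hA
  have h1 : A.card ≤ hF.toFinset.card := by
    refine Finset.card_le_card_of_injOn (fun p => s(p.1, p.2)) ?_ ?_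
    · rintro ⟨x, y⟩ h
      simp only [hA, Finset.coe_filter, Set.mem_setOf_eq] at h
      simpa using h.2.2
    · rintro ⟨x, y⟩ h ⟨x', y'⟩ h' he
      simp only [hA, Finset.coe_filter, Set.mem_setOf_eq, Finset.mem_product, Finset.mem_compl] at h h'
      simp only [Sym2.eq_iff] at he
      rcases he with ⟨rfl, rfl⟩ | ⟨rfl, rfl⟩
      · rfl
      · exact absurd h.1.1 h'.1.2
  refine le_trans ?_ (Nat.add_le_add_left h1 _)
  refine le_trans (Finset.card_le_card ?_) (Finset.card_union_le _ _)
  rintro ⟨x, y⟩ h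
  simp only [hA, Finset.mem_union, Finset.mem_filter, SimpleGraph.deleteEdges_adj] at h ⊢
  tauto

lemma ecut_compl {V : Type*} [Fintype V] [DecidableEq V] (G : SimpleGraph V) (X : Finset V) :
    ecut G Xᶜ = ecut G X := by
  classical
  refine Finset.card_bij (fun p _ => (p.2, p.1)) ?_ ?_ ?_
  · rintro ⟨x, y⟩ h
    simp at h ⊢
    exact ⟨⟨h.1.2, h.1.1⟩, h.2.symm⟩
  · rintro ⟨x, y⟩ _ ⟨x', y'⟩ _ h
    simp at h ⊢; tauto
  · rintro ⟨x, y⟩ h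
    simp at h
    exact ⟨(y, x), by simp; exact ⟨⟨h.1.2, h.1.1⟩, h.2.symm⟩, rfl⟩

lemma ecut_small (n : ℕ) (F : Set (Sym2 (Perm (Fin n))))
    (hmin : ∀ w : Perm (Fin n), 2 ≤ deg ((BS n).deleteEdges F) w)
    (X : Finset (Perm (Fin n))) (hX : X.card ≤ 3) (u : Perm (Fin n)) (hu : u ∈ X) :
    deg ((BS n).deleteEdges F) u ≤ ecut ((BS n).deleteEdges F) X := by
  classical
  set G := (BS n).deleteEdges F with hG
  have hdeg : ∀ w, deg G w = (Finset.univ.filter (fun y => G.Adj w y)).card := by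
    intro w
    rw [deg, Set.ncard_eq_toFinset_card']
    congr 1; ext y; simp
  set D := (X ×ˢ X).filter (fun p => G.Adj p.1 p.2) with hD
  have hsum : ∑ x ∈ X, deg G x ≤ ecut G X + D.card := by
    have h1 : ∑ x ∈ X, deg G x = ((X ×ˢ Finset.univ).filter (fun p => G.Adj p.1 p.2)).card := by
      rw [Finset.card_filter, Finset.sum_product]
      refine Finset.sum_congr rfl fun x _ => ?_
      rw [hdeg, Finset.card_filter]
    rw [h1]
    refine le_trans (Finset.card_le_card ?_) (Finset.card_union_le _ _)
    rintro ⟨x, y⟩ h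
    simp [hD] at h ⊢
    tauto
  have hlow : deg G u + 2 * (X.card - 1) ≤ ∑ x ∈ X, deg G x := by
    rw [← Finset.add_sum_erase _ _ hu]
    refine Nat.add_le_add_left ?_ _
    rw [← Finset.card_erase_of_mem hu, mul_comm, ← smul_eq_mul, ← Finset.sum_const]
    exact Finset.sum_le_sum fun x _ => hmin x
  have hDc : D.card ≤ 2 * (X.card - 1) := by
    set P := X.filter (fun x => Perm.sign x = 1) with hP
    set Q := X.filter (fun x => ¬ Perm.sign x = 1) with hQ
    have hPQ : P.card + Q.card = X.card :=
      Finset.card_filter_add_card_filter_not (s := X) (fun x => Perm.sign x = 1)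
    have h1 : D.card ≤ P.card * Q.card + Q.card * P.card := by
      rw [← Finset.card_product, ← Finset.card_product]
      refine le_trans (Finset.card_le_card ?_) (Finset.card_union_le _ _)
      rintro ⟨x, y⟩ h
      simp only [hD, Finset.mem_filter, Finset.mem_product, hG, SimpleGraph.deleteEdges_adj] at h
      have hs := BS_adj_sign n x y h.2.1
      simp only [hP, hQ, Finset.mem_union, Finset.mem_product, Finset.mem_filter]
      rcases Int.units_eq_one_or (Perm.sign x) with hx | hx <;> rw [hx] at hs <;> simp [hs, hx, h.1]
    have hpos : 1 ≤ X.card := Finset.card_pos.2 ⟨u, hu⟩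
    have : P.card ≤ 3 := by omega
    generalize P.card = p at *
    generalize Q.card = q at *
    rw [← hPQ] at hX hpos ⊢
    interval_cases p <;> omega
  omega

end Final

theorem BS_conditional_fault_tolerant_Menger (n : ℕ) (hn : 4 ≤ n)
    (F : Set (Sym2 (Equiv.Perm (Fin n)))) (hF : F ⊆ (BS n).edgeSet)
    (hcard : F.ncard ≤ 6 * n - 17)
    (hmin : ∀ w : Equiv.Perm (Fin n), 2 ≤ deg ((BS n).deleteEdges F) w)
    (u v : Equiv.Perm (Fin n)) (huv : u ≠ v) :
    HasEdgeDisjointPaths ((BS n).deleteEdges F) u v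
      (min (deg ((BS n).deleteEdges F) u) (deg ((BS n).deleteEdges F) v)) := by
  refine menger_edge huv _ ?_
  intro X hu hv
  by_cases h1 : X.card ≤ 3
  · exact (min_le_left _ _).trans (ecut_small n F hmin X h1 u hu)
  by_cases h2 : Xᶜ.card ≤ 3
  · refine (min_le_right _ _).trans ?_
    rw [← ecut_compl]
    exact ecut_small n F hmin Xᶜ h2 v (by simpa using hv)
  refine (min_le_left _ _).trans ?_
  have hdeg : deg ((BS n).deleteEdges F) u ≤ 2 * n - 3 := by
    refine le_trans ?_ (gens_card n (by omega))
    rw [deg]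
    refine le_trans (Set.ncard_le_ncard (t := ((gens n).image (fun s => u * s) : Finset _)) ?_
      (Finset.finite_toSet _)) ?_
    · intro y hy
      rw [SimpleGraph.mem_neighborSet, SimpleGraph.deleteEdges_adj, BS_adj_iff] at hy
      obtain ⟨⟨s, hs, rfl⟩, -⟩ := hy
      exact Finset.mem_coe.2 (Finset.mem_image_of_mem _ hs)
    · rw [Set.ncard_coe_finset]; exact Finset.card_image_le
  have h3 := gcut_lower n (by omega) X
  have h4 := gcut_le_ecut n X
  have h5 := ecut_delete (BS n) F X
  rw [Finset.card_compl, Fintype.card_perm, Fintype.card_fin] at h2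
  have h6 : FF n (min X.card (n.factorial - X.card)) = 8 * n - 20 := by
    unfold FF; split_ifs <;> omega
  omega
end
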